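/- For every k ≥ 1 there exists θ_c > 0, depending only on k, with the following property: for every pattern σ ∈ S_k, every μ ∈ ℳ and every θ ∈ (−θ_c,θ_c), the supremum sup_{ν∈ℳ}{θ t_σ(ν) − D(ν|μ)} has a unique maximizer ν_{σ,μ,θ} ∈ ℳ, and the Lévy–Prokhorov distance between Em(π_{n,σ,μ,θ}) and 𝒪(ν_{σ,μ,θ}) converges to 0 in probability as n → ∞. -/

import Mathlib

open MeasureTheory Filter Topology
open scoped ENNReal

noncomputable section

/-- The plane `ℝ²`, carrier for measures on the unit square. -/
abbrev Ω2 : Type := ℝ × ℝ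

/-- The unit square `[0,1]² ⊆ ℝ²`. -/
def unitSq : Set Ω2 := Set.Icc (0 : ℝ) 1 ×ˢ Set.Icc (0 : ℝ) 1

/-- Lebesgue measure on the unit square. -/
def lebSq : Measure Ω2 := volume.restrict unitSq

/-- `𝒫`: Borel probability measures concentrated on the unit square. -/
def Pcal : Set (ProbabilityMeasure Ω2) := {μ | (μ : Measure Ω2) unitSq = 1}

/-- `ℳ`: members of `𝒫` whose two coordinate marginals are atomless
(equivalently, have continuous CDFs). -/
def Mcal : Set (ProbabilityMeasure Ω2) :=
  {μ | μ ∈ Pcal ∧ (∀ x : ℝ, (μ : Measure Ω2).map Prod.fst {x} = 0) ∧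
      ∀ y : ℝ, (μ : Measure Ω2).map Prod.snd {y} = 0}

/-- The uniform distribution on `[0,1]`. -/
def unif01 : Measure ℝ := volume.restrict (Set.Icc (0 : ℝ) 1)

/-- `ℳ̃`: permutons, i.e. members of `𝒫` with both marginals uniform on `[0,1]`. -/
def Mtilde : Set (ProbabilityMeasure Ω2) :=
  {μ | μ ∈ Pcal ∧ (μ : Measure Ω2).map Prod.fst = unif01 ∧
      (μ : Measure Ω2).map Prod.snd = unif01}

open scoped Classical in
/-- `h_σ`: indicator that the `k` points induce the pattern `σ`. -/
def hPat {k : ℕ} (σ : Equiv.Perm (Fin k)) (z : Fin k → Ω2) : ℝ :=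
  if ∃ τ : Equiv.Perm (Fin k),
      StrictMono (fun i => (z (τ i)).1) ∧ StrictMono (fun i => (z (τ (σ⁻¹ i))).2)
  then 1 else 0

/-- Pattern density `t_σ(ν) = ∫ h_σ dν^{⊗k}`. -/
def tPat {k : ℕ} (σ : Equiv.Perm (Fin k)) (ν : Measure Ω2) : ℝ :=
  ∫ z, hPat σ z ∂(Measure.pi fun _ : Fin k => ν)

open scoped Classical in
/-- The permutation induced by `n` labelled points of `ℝ²` (junk value `1` if the
coordinates are not in generic position). -/
def inducedPerm {n : ℕ} (z : Fin n → Ω2) : Equiv.Perm (Fin n) :=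
  if h : ∃ σ : Equiv.Perm (Fin n), hPat σ z = 1 then h.choose else 1

/-- Empirical measure `Em(π) = (1/n) ∑ δ_{(i/n, π(i)/n)}` of a permutation, as a measure. -/
def EmM {n : ℕ} (π : Equiv.Perm (Fin n)) : Measure Ω2 :=
  (n : ℝ≥0∞)⁻¹ • ∑ i : Fin n, Measure.dirac ((((i : ℕ) + 1 : ℝ)) / n, (((π i : ℕ) + 1 : ℝ)) / n)

open scoped Classical in
/-- Empirical measure of a permutation as a probability measure (junk value for `n = 0`). -/
def EmP {n : ℕ} (π : Equiv.Perm (Fin n)) : ProbabilityMeasure Ω2 :=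
  if h : IsProbabilityMeasure (EmM π) then ⟨EmM π, h⟩
  else ⟨Measure.dirac 0, by infer_instance⟩

/-- `t_σ(π) := t_σ(Em(π))`. -/
def tPerm {k n : ℕ} (σ : Equiv.Perm (Fin k)) (π : Equiv.Perm (Fin n)) : ℝ := tPat σ (EmM π)

open scoped Classical in
/-- Kullback–Leibler divergence `D(ν|μ) ∈ [0,∞]`; for probability measures with `ν ≪ μ`
it equals `∫ log(dν/dμ) dν`, written here through the nonnegative integrand
`g log g + 1 - g` of the density `g = dν/dμ` (the correction `∫ (1-g) dμ = 0`). -/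
def KL (ν μ : Measure Ω2) : ℝ≥0∞ :=
  if ν ≪ μ then
    ∫⁻ z, ENNReal.ofReal ((ν.rnDeriv μ z).toReal * Real.log ((ν.rnDeriv μ z).toReal)
      + 1 - (ν.rnDeriv μ z).toReal) ∂μ
  else ∞

/-- CDF of the first marginal. -/
def cdfX (μ : Measure Ω2) (x : ℝ) : ℝ := (μ {p : Ω2 | p.1 ≤ x}).toReal

/-- CDF of the second marginal. -/
def cdfY (μ : Measure Ω2) (y : ℝ) : ℝ := (μ {p : Ω2 | p.2 ≤ y}).toReal

/-- The map `𝒪`: pushforward of `μ` under `(x,y) ↦ (F₁(x), F₂(y))`. -/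
def Omap (μ : Measure Ω2) : Measure Ω2 := μ.map fun p => (cdfX μ p.1, cdfY μ p.2)

/-- The product measure `μ^{⊗n}` governing `n` i.i.d. samples. -/
def pmeas (μ : Measure Ω2) (n : ℕ) : Measure (Fin n → Ω2) := Measure.pi fun _ => μ

/-- Log-partition function `F_n(σ,μ,θ) = log E[exp(nθ t_σ(π_{n,μ}))]`. -/
def Fn {k : ℕ} (σ : Equiv.Perm (Fin k)) (μ : Measure Ω2) (θ : ℝ) (n : ℕ) : ℝ :=
  Real.log (∫ z, Real.exp (n * θ * tPerm σ (inducedPerm z)) ∂pmeas μ n)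

/-- The Gibbs measure `Q_{n,σ,μ,θ}` on `([0,1]²)ⁿ`. -/
def Qgibbs {k : ℕ} (σ : Equiv.Perm (Fin k)) (μ : Measure Ω2) (θ : ℝ) (n : ℕ) :
    Measure (Fin n → Ω2) :=
  (pmeas μ n).withDensity fun z =>
    ENNReal.ofReal (Real.exp (n * θ * tPerm σ (inducedPerm z) - Fn σ μ θ n))

/-- `F(σ,μ,θ) = sup_{ν ∈ ℳ} { θ t_σ(ν) − D(ν|μ) }`, valued in `EReal`. -/
def Fsup {k : ℕ} (σ : Equiv.Perm (Fin k)) (μ : Measure Ω2) (θ : ℝ) : EReal :=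
  ⨆ ν ∈ Mcal, (((θ * tPat σ (ν : Measure Ω2) : ℝ) : EReal) - ((KL (↑ν) μ : ℝ≥0∞) : EReal))

/-- `ℱ(σ,μ,θ)`: the set of maximizers of `ν ↦ θ t_σ(ν) − D(ν|μ)` over `ℳ`. -/
def Fset {k : ℕ} (σ : Equiv.Perm (Fin k)) (μ : Measure Ω2) (θ : ℝ) :
    Set (ProbabilityMeasure Ω2) :=
  {ν | ν ∈ Mcal ∧
    (((θ * tPat σ (ν : Measure Ω2) : ℝ) : EReal) - ((KL (↑ν) μ : ℝ≥0∞) : EReal)) = Fsup σ μ θ}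

/-- `G(σ,μ,δ) = inf { D(ν|μ) : ν ∈ ℳ, t_σ(ν) ≥ δ }`. -/
def Gfun {k : ℕ} (σ : Equiv.Perm (Fin k)) (μ : Measure Ω2) (δ : ℝ) : ℝ≥0∞ :=
  ⨅ ν ∈ {ν : ProbabilityMeasure Ω2 | ν ∈ Mcal ∧ δ ≤ tPat σ (ν : Measure Ω2)}, KL (↑ν) μ

/-- `𝒢(σ,μ,δ)`: the set of minimizers in the definition of `G(σ,μ,δ)`. -/
def Gset {k : ℕ} (σ : Equiv.Perm (Fin k)) (μ : Measure Ω2) (δ : ℝ) :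
    Set (ProbabilityMeasure Ω2) :=
  {ν | (ν ∈ Mcal ∧ δ ≤ tPat σ (ν : Measure Ω2)) ∧ KL (↑ν) μ = Gfun σ μ δ}

/-- `α_σ(μ) = inf {δ : G(σ,μ,δ) = ∞}`. -/
def alphaSig {k : ℕ} (σ : Equiv.Perm (Fin k)) (μ : Measure Ω2) : ℝ :=
  sInf {δ : ℝ | Gfun σ μ δ = ∞}

/-- `μ` is conditionally constant (CC) with respect to a pattern `σ` of size `k+1`:
the conditional probability `P(π_{X,Y} = σ | (X₁,Y₁))`, which for i.i.d. samples equals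
`z ↦ ∫ h_σ(z, w) dμ^{⊗k}(w)`, is `μ`-a.s. equal to a constant `c ∈ [0,1]`. -/
def IsCC {k : ℕ} (σ : Equiv.Perm (Fin (k + 1))) (μ : Measure Ω2) : Prop :=
  ∃ c ∈ Set.Icc (0 : ℝ) 1, ∀ᵐ z ∂μ,
    (∫ w : Fin k → Ω2, hPat σ (Fin.cons z w) ∂pmeas μ k) = c

/-- The inversion pattern `21 ∈ S₂`. -/
def inv2 : Equiv.Perm (Fin 2) := Equiv.swap 0 1

/-- Lévy–Prokhorov (extended) distance between measures on `ℝ²`. -/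
def dLPE (μ ν : Measure Ω2) : ℝ≥0∞ := levyProkhorovEDist μ ν

/-- The topological support of a measure: the points whose every open neighbourhood
has positive measure. -/
def msupport (μ : Measure Ω2) : Set Ω2 :=
  {z | ∀ U : Set Ω2, IsOpen U → z ∈ U → 0 < μ U}


section ProductExpansion

/-- First-order expansion of a product of real numbers, with error linear in the increments. -/
theorem abs_prod_sub_prod_le {ι : Type*} [DecidableEq ι] (s : Finset ι) (a b : ι → ℝ)
    (ha : ∀ i, 0 ≤ a i) (hb : ∀ i, 0 ≤ b i) :
    |∏ i ∈ s, a i - ∏ i ∈ s, b i| ≤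
      ∑ i ∈ s, ∏ l ∈ s, (if l = i then |a l - b l| else a l + b l) := by
  induction s using Finset.induction_on with
  | empty => simp
  | insert x s hx ih =>
    have hne : ∀ l ∈ s, l ≠ x := fun l hl h => hx (h ▸ hl)
    have hA : 0 ≤ ∏ i ∈ s, a i := Finset.prod_nonneg fun i _ => ha i
    have hle : ∏ i ∈ s, a i ≤ ∏ l ∈ s, (a l + b l) :=
      Finset.prod_le_prod (fun i _ => ha i) fun i _ => by linarith [hb i]
    rw [Finset.prod_insert hx, Finset.prod_insert hx, Finset.sum_insert hx,
      Finset.prod_insert hx]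
    have e1 : ∏ l ∈ s, (if l = x then |a l - b l| else a l + b l) = ∏ l ∈ s, (a l + b l) :=
      Finset.prod_congr rfl fun l hl => if_neg (hne l hl)
    have e2 : ∑ i ∈ s, ∏ l ∈ insert x s, (if l = i then |a l - b l| else a l + b l) =
        (a x + b x) * ∑ i ∈ s, ∏ l ∈ s, (if l = i then |a l - b l| else a l + b l) := by
      rw [Finset.mul_sum]
      refine Finset.sum_congr rfl fun i hi => ?_
      rw [Finset.prod_insert hx, if_neg (hne i hi).symm]
    rw [e1, e2, if_pos rfl]
    set S := ∑ i ∈ s, ∏ l ∈ s, (if l = i then |a l - b l| else a l + b l)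
    have hS : 0 ≤ S := (abs_nonneg _).trans ih
    calc |a x * ∏ i ∈ s, a i - b x * ∏ i ∈ s, b i|
        = |(a x - b x) * ∏ i ∈ s, a i + b x * (∏ i ∈ s, a i - ∏ i ∈ s, b i)| := by ring_nf
      _ ≤ |a x - b x| * ∏ i ∈ s, a i + b x * |∏ i ∈ s, a i - ∏ i ∈ s, b i| := by
        refine (abs_add_le _ _).trans_eq ?_
        rw [abs_mul, abs_mul, abs_of_nonneg hA, abs_of_nonneg (hb x)]
      _ ≤ |a x - b x| * ∏ l ∈ s, (a l + b l) + (a x + b x) * S := by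
        gcongr
        · exact add_nonneg (ha x) (hb x)
        · exact le_add_of_nonneg_left (ha x)

/-- Second-order expansion of a product of real numbers, with error quadratic in the
increments. -/
theorem abs_prod_sub_prod_sub_sum_le {ι : Type*} [DecidableEq ι] (s : Finset ι) (a b : ι → ℝ)
    (ha : ∀ i, 0 ≤ a i) (hb : ∀ i, 0 ≤ b i) :
    |∏ i ∈ s, a i - ∏ i ∈ s, b i -
        ∑ i ∈ s, (∏ l ∈ s, (if l = i then a l else b l) - ∏ l ∈ s, b l)| ≤
      ∑ i ∈ s, ∑ j ∈ s, if i = j then 0 else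
        ∏ l ∈ s, (if l = i ∨ l = j then |a l - b l| else a l + b l) := by
  induction s using Finset.induction_on with
  | empty => simp
  | insert x s hx ih =>
    have hne : ∀ l ∈ s, l ≠ x := fun l hl h => hx (h ▸ hl)
    have h1 := abs_prod_sub_prod_le s a b ha hb
    set A := ∏ i ∈ s, a i with hA
    set B := ∏ i ∈ s, b i with hB
    set S1 := ∑ i ∈ s, ∏ l ∈ s, (if l = i then |a l - b l| else a l + b l) with hS1
    set E1 := ∑ i ∈ s, (∏ l ∈ s, (if l = i then a l else b l) - B) with hE1
    set S2 := ∑ i ∈ s, ∑ j ∈ s, (if i = j then 0 else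
        ∏ l ∈ s, (if l = i ∨ l = j then |a l - b l| else a l + b l)) with hS2
    have hS2n : 0 ≤ S2 := (abs_nonneg _).trans ih
    have eL : ∑ i ∈ insert x s, (∏ l ∈ insert x s, (if l = i then a l else b l) -
        ∏ l ∈ insert x s, b l) = (a x - b x) * B + b x * E1 := by
      rw [Finset.sum_insert hx, Finset.prod_insert hx, Finset.prod_insert hx, if_pos rfl,
        Finset.prod_congr rfl fun l hl => if_neg (hne l hl), ← hB, hE1, Finset.mul_sum]
      congr 1
      · ring
      · refine Finset.sum_congr rfl fun i hi => ?_
        rw [Finset.prod_insert hx, if_neg (hne i hi).symm]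
        ring
    have c1 : ∀ j ∈ s, (∏ l ∈ insert x s, (if l = x ∨ l = j then |a l - b l| else a l + b l)) =
        |a x - b x| * ∏ l ∈ s, (if l = j then |a l - b l| else a l + b l) := by
      intro j hj
      rw [Finset.prod_insert hx, if_pos (Or.inl rfl)]
      congr 1
      refine Finset.prod_congr rfl fun l hl => ?_
      simp [hne l hl]
    have eR : (∑ i ∈ insert x s, ∑ j ∈ insert x s, if i = j then 0 else
        ∏ l ∈ insert x s, (if l = i ∨ l = j then |a l - b l| else a l + b l)) =
        |a x - b x| * S1 + |a x - b x| * S1 + (a x + b x) * S2 := by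
      rw [Finset.sum_insert hx, Finset.sum_insert hx, if_pos rfl, zero_add]
      have t1 : (∑ j ∈ s, if x = j then 0 else
          ∏ l ∈ insert x s, (if l = x ∨ l = j then |a l - b l| else a l + b l)) =
          |a x - b x| * S1 := by
        rw [hS1, Finset.mul_sum]
        refine Finset.sum_congr rfl fun j hj => ?_
        rw [if_neg (hne j hj).symm, c1 j hj]
      have t2 : (∑ i ∈ s, ∑ j ∈ insert x s, if i = j then 0 else
          ∏ l ∈ insert x s, (if l = i ∨ l = j then |a l - b l| else a l + b l)) =
          |a x - b x| * S1 + (a x + b x) * S2 := by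
        rw [hS1, hS2, Finset.mul_sum, Finset.mul_sum, ← Finset.sum_add_distrib]
        refine Finset.sum_congr rfl fun i hi => ?_
        rw [Finset.sum_insert hx, if_neg (hne i hi), Finset.mul_sum]
        congr 1
        · rw [← c1 i hi]
          exact Finset.prod_congr rfl fun l _ => by simp only [or_comm]
        · refine Finset.sum_congr rfl fun j hj => ?_
          split_ifs
          · simp
          · rw [Finset.prod_insert hx, if_neg]
            rintro (h | h)
            · exact hne i hi h.symm
            · exact hne j hj h.symm
      rw [t1, t2]; ring
    rw [eL, eR, Finset.prod_insert hx, Finset.prod_insert hx, ← hA, ← hB]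
    have hS1n : 0 ≤ S1 := (abs_nonneg _).trans h1
    calc |a x * A - b x * B - ((a x - b x) * B + b x * E1)|
        = |(a x - b x) * (A - B) + b x * (A - B - E1)| := by ring_nf
      _ ≤ |a x - b x| * |A - B| + b x * |A - B - E1| := by
        refine (abs_add_le _ _).trans_eq ?_
        rw [abs_mul, abs_mul, abs_of_nonneg (hb x)]
      _ ≤ |a x - b x| * S1 + (a x + b x) * S2 := by
        gcongr
        · exact add_nonneg (ha x) (hb x)
        · exact le_add_of_nonneg_left (ha x)
      _ ≤ _ := by
        have := mul_nonneg (abs_nonneg (a x - b x)) hS1n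
        linarith

end ProductExpansion

section Densities

variable {E : Type*} [MeasurableSpace E]

/-- `f` is a probability density with respect to `lam`. -/
structure IsProbDensity (lam : Measure E) (f : E → ℝ) : Prop where
  measurable : Measurable f
  nonneg : ∀ x, 0 ≤ f x
  integrable : Integrable f lam
  integral_eq : ∫ x, f x ∂lam = 1

/-- The measure with real density `f` with respect to `lam`. -/
def densMeasure (lam : Measure E) (f : E → ℝ) : Measure E :=
  lam.withDensity fun x => ENNReal.ofReal (f x)

theorem IsProbDensity.isProbabilityMeasure {lam : Measure E} {f : E → ℝ}
    (hf : IsProbDensity lam f) : IsProbabilityMeasure (densMeasure lam f) := by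
  constructor
  rw [densMeasure, withDensity_apply _ MeasurableSet.univ, Measure.restrict_univ,
    ← ofReal_integral_eq_lintegral_ofReal hf.integrable (ae_of_all _ hf.nonneg), hf.integral_eq,
    ENNReal.ofReal_one]

theorem integral_densMeasure {lam : Measure E} {f : E → ℝ} (hf : Measurable f)
    (h0 : ∀ x, 0 ≤ f x) (φ : E → ℝ) :
    ∫ x, φ x ∂densMeasure lam f = ∫ x, f x * φ x ∂lam := by
  rw [densMeasure, integral_withDensity_eq_integral_toReal_smul hf.ennreal_ofReal
    (ae_of_all _ fun _ => ENNReal.ofReal_lt_top)]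
  simp only [smul_eq_mul, ENNReal.toReal_ofReal (h0 _)]

theorem pi_densMeasure {ι : Type*} [Fintype ι] {lam : Measure E} [SigmaFinite lam]
    {f : ι → E → ℝ} (hf : ∀ i, IsProbDensity lam (f i)) :
    Measure.pi (fun i => densMeasure lam (f i)) =
      densMeasure (Measure.pi fun _ : ι => lam) (fun w => ∏ i, f i (w i)) := by
  have := fun i => (hf i).isProbabilityMeasure
  refine Measure.pi_eq fun s hs => ?_
  rw [densMeasure, withDensity_apply _ (MeasurableSet.univ_pi hs),
    ← lintegral_indicator (MeasurableSet.univ_pi hs)]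
  have h1 : ∀ w : ι → E, (Set.univ.pi s).indicator
      (fun w => ENNReal.ofReal (∏ i, f i (w i))) w =
      ENNReal.ofReal (∏ i, (s i).indicator (f i) (w i)) := by
    intro w
    by_cases hw : w ∈ Set.univ.pi s
    · rw [Set.indicator_of_mem hw]
      congr 1
      exact Finset.prod_congr rfl fun i _ => (Set.indicator_of_mem (hw i trivial) _).symm
    · rw [Set.indicator_of_notMem hw]
      simp only [Set.mem_univ_pi, not_forall] at hw
      obtain ⟨i, hi⟩ := hw
      rw [Finset.prod_eq_zero (Finset.mem_univ i) (Set.indicator_of_notMem hi _),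
        ENNReal.ofReal_zero]
  simp_rw [h1]
  have hint : ∀ i, Integrable ((s i).indicator (f i)) lam :=
    fun i => (hf i).integrable.indicator (hs i)
  have hnn : ∀ i x, 0 ≤ (s i).indicator (f i) x :=
    fun i x => Set.indicator_nonneg (fun x _ => (hf i).nonneg x) x
  rw [← ofReal_integral_eq_lintegral_ofReal (Integrable.fintype_prod hint)
    (ae_of_all _ fun w => Finset.prod_nonneg fun i _ => hnn i _),
    integral_fintype_prod_eq_prod, ENNReal.ofReal_prod_of_nonneg
      (fun i _ => integral_nonneg (hnn i))]
  refine Finset.prod_congr rfl fun i _ => ?_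
  rw [ofReal_integral_eq_lintegral_ofReal (hint i) (ae_of_all _ (hnn i)), densMeasure,
    withDensity_apply _ (hs i), ← lintegral_indicator (hs i)]
  refine lintegral_congr fun x => ?_
  by_cases hx : x ∈ s i <;> simp [hx]

theorem integral_pi_densMeasure {ι : Type*} [Fintype ι] {lam : Measure E} [SigmaFinite lam]
    {f : ι → E → ℝ} (hf : ∀ i, IsProbDensity lam (f i)) (φ : (ι → E) → ℝ) :
    ∫ w, φ w ∂Measure.pi (fun i => densMeasure lam (f i)) =
      ∫ w, (∏ i, f i (w i)) * φ w ∂Measure.pi (fun _ : ι => lam) := by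
  rw [pi_densMeasure hf, integral_densMeasure]
  · exact Finset.measurable_prod _ fun i _ => (hf i).measurable.comp (measurable_pi_apply i)
  · exact fun w => Finset.prod_nonneg fun i _ => (hf i).nonneg _

theorem measurable_update_prod {ι : Type*} [DecidableEq ι] (i : ι) :
    Measurable fun p : E × (ι → E) => Function.update p.2 i p.1 :=
  measurable_pi_iff.2 fun j => by
    by_cases h : j = i
    · subst h; simpa using measurable_fst
    · simp only [Function.update_of_ne h]
      exact (measurable_pi_apply j).comp measurable_snd

/-- Resampling one coordinate of a product of probability measures. -/
theorem map_update_prod_pi {ι : Type*} [Fintype ι] [DecidableEq ι] (P : ι → Measure E)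
    [∀ i, IsProbabilityMeasure (P i)] (Q : Measure E) [IsProbabilityMeasure Q] (i : ι) :
    (Q.prod (Measure.pi P)).map (fun p => Function.update p.2 i p.1) =
      Measure.pi (Function.update P i Q) := by
  have hm := measurable_update_prod (E := E) i
  have : ∀ j, IsProbabilityMeasure (Function.update P i Q j) := by
    intro j
    by_cases h : j = i
    · subst h; simpa
    · simp only [Function.update_of_ne h]; infer_instance
  refine (Measure.pi_eq fun s hs => ?_).symm
  rw [Measure.map_apply hm (MeasurableSet.univ_pi hs)]
  have e : (fun p : E × (ι → E) => Function.update p.2 i p.1) ⁻¹' Set.univ.pi s =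
      s i ×ˢ Set.univ.pi (Function.update s i Set.univ) := by
    ext ⟨x, w⟩
    simp only [Set.mem_preimage, Set.mem_univ_pi, Set.mem_prod]
    constructor
    · intro h
      refine ⟨by simpa using h i, fun j => ?_⟩
      by_cases hj : j = i
      · subst hj; simp
      · simpa [Function.update_of_ne hj] using h j
    · rintro ⟨h1, h2⟩ j
      by_cases hj : j = i
      · subst hj; simpa
      · simpa [Function.update_of_ne hj] using h2 j
  rw [e, Measure.prod_prod, Measure.pi_pi, ← Finset.mul_prod_erase _ _ (Finset.mem_univ i),
    ← Finset.mul_prod_erase (Finset.univ) (fun j => Function.update P i Q j (s j))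
      (Finset.mem_univ i)]
  simp only [Function.update_self, measure_univ, one_mul]
  congr 1
  refine Finset.prod_congr rfl fun j hj => ?_
  have hj' := Finset.ne_of_mem_erase hj
  simp [Function.update_of_ne hj']

end Densities

section Expansion

variable {E : Type*} [MeasurableSpace E] {ι : Type*} [Fintype ι]

theorem integral_ite_add_eq {lam : Measure E} {f g : E → ℝ}
    (hf : IsProbDensity lam f) (hg : IsProbDensity lam g) (p : Prop) [Decidable p] :
    ∫ x, (if p then |f x - g x| else f x + g x) ∂lam =
      if p then ∫ x, |f x - g x| ∂lam else 2 := by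
  split_ifs
  · rfl
  · rw [integral_add hf.integrable hg.integrable, hf.integral_eq, hg.integral_eq]; norm_num

theorem integrable_ite_add {lam : Measure E} {f g : E → ℝ}
    (hf : IsProbDensity lam f) (hg : IsProbDensity lam g) (p : Prop) [Decidable p] :
    Integrable (fun x => if p then |f x - g x| else f x + g x) lam := by
  split_ifs
  · exact (hf.integrable.sub hg.integrable).abs
  · exact hf.integrable.add hg.integrable

theorem IsProbDensity.integrable_prod_mul {lam : Measure E} [SigmaFinite lam]
    {f : ι → E → ℝ} (hf : ∀ i, IsProbDensity lam (f i)) {φ : (ι → E) → ℝ} (hφ : Measurable φ)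
    (hb : ∀ w, |φ w| ≤ 1) :
    Integrable (fun w => (∏ i, f i (w i)) * φ w) (Measure.pi fun _ : ι => lam) := by
  have h := Integrable.fintype_prod (μ := fun _ : ι => lam) fun i => (hf i).integrable
  refine h.mono' (h.aestronglyMeasurable.mul hφ.aestronglyMeasurable) (ae_of_all _ fun w => ?_)
  have h0 : 0 ≤ ∏ i, f i (w i) := Finset.prod_nonneg fun i _ => (hf i).nonneg _
  rw [norm_mul, Real.norm_eq_abs, Real.norm_eq_abs, abs_of_nonneg h0]
  exact mul_le_of_le_one_right h0 (hb w)

/-- Lipschitz dependence of the integral of a bounded function against a product measure. -/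
theorem abs_integral_pi_sub_le [DecidableEq ι] {lam : Measure E} [SigmaFinite lam] {f g : E → ℝ}
    (hf : IsProbDensity lam f) (hg : IsProbDensity lam g) {φ : (ι → E) → ℝ} (hφ : Measurable φ)
    (hb : ∀ w, |φ w| ≤ 1) :
    |∫ w, φ w ∂Measure.pi (fun _ : ι => densMeasure lam f) -
        ∫ w, φ w ∂Measure.pi (fun _ : ι => densMeasure lam g)| ≤
      Fintype.card ι * 2 ^ Fintype.card ι * ∫ x, |f x - g x| ∂lam := by
  rw [integral_pi_densMeasure fun _ => hf, integral_pi_densMeasure fun _ => hg,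
    ← integral_sub (IsProbDensity.integrable_prod_mul (fun _ => hf) hφ hb)
      (IsProbDensity.integrable_prod_mul (fun _ => hg) hφ hb)]
  have hI : ∀ i : ι, Integrable (fun w : ι → E => ∏ l, (if l = i then |f (w l) - g (w l)|
      else f (w l) + g (w l))) (Measure.pi fun _ : ι => lam) := fun i =>
    Integrable.fintype_prod (f := fun l x => if l = i then |f x - g x| else f x + g x)
      fun l => integrable_ite_add hf hg _
  have hδ : 0 ≤ ∫ x, |f x - g x| ∂lam := integral_nonneg fun x => abs_nonneg _
  calc _ ≤ ∫ w : ι → E, ∑ i, ∏ l, (if l = i then |f (w l) - g (w l)| else f (w l) + g (w l))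
        ∂Measure.pi (fun _ : ι => lam) := by
        refine (abs_integral_le_integral_abs).trans (integral_mono_of_nonneg
          (ae_of_all _ fun w => abs_nonneg _) (integrable_finsetSum _ fun i _ => hI i)
          (ae_of_all _ fun w => ?_))
        simp only
        rw [← sub_mul, abs_mul]
        refine (mul_le_of_le_one_right (abs_nonneg _) (hb w)).trans ?_
        exact abs_prod_sub_prod_le _ (fun i => f (w i)) (fun i => g (w i))
          (fun _ => hf.nonneg _) fun _ => hg.nonneg _
    _ = ∑ i : ι, ∏ l, (if l = i then ∫ x, |f x - g x| ∂lam else 2) := by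
        rw [integral_finsetSum _ fun i _ => hI i]
        refine Finset.sum_congr rfl fun i _ => ?_
        rw [integral_fintype_prod_eq_prod
          (fun l x => if l = i then |f x - g x| else f x + g x)]
        exact Finset.prod_congr rfl fun l _ => integral_ite_add_eq hf hg _
    _ ≤ ∑ i : ι, 2 ^ Fintype.card ι * ∫ x, |f x - g x| ∂lam := by
        refine Finset.sum_le_sum fun i _ => ?_
        calc _ ≤ ∏ l : ι, (2 * (if l = i then ∫ x, |f x - g x| ∂lam else 1)) := by
              refine Finset.prod_le_prod (fun l _ => by split_ifs <;> positivity) fun l _ => ?_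
              split_ifs <;> linarith
          _ = _ := by
              rw [Finset.prod_mul_distrib, Finset.prod_ite_eq', if_pos (Finset.mem_univ i)]
              simp
    _ = _ := by simp [mul_assoc]

/-- First-order Taylor expansion of `P ↦ ∫ φ d P^{⊗ι}` in total variation. -/
theorem abs_integral_pi_sub_sub_sum_le [DecidableEq ι] {lam : Measure E} [SigmaFinite lam] {f g : E → ℝ}
    (hf : IsProbDensity lam f) (hg : IsProbDensity lam g) {φ : (ι → E) → ℝ} (hφ : Measurable φ)
    (hb : ∀ w, |φ w| ≤ 1) :
    |∫ w, φ w ∂Measure.pi (fun _ : ι => densMeasure lam f) -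
        ∫ w, φ w ∂Measure.pi (fun _ : ι => densMeasure lam g) -
        ∑ i : ι, (∫ w, φ w ∂Measure.pi
            (Function.update (fun _ : ι => densMeasure lam g) i (densMeasure lam f)) -
          ∫ w, φ w ∂Measure.pi (fun _ : ι => densMeasure lam g))| ≤
      Fintype.card ι ^ 2 * 2 ^ Fintype.card ι * (∫ x, |f x - g x| ∂lam) ^ 2 := by
  have hup : ∀ i : ι, Function.update (fun _ : ι => densMeasure lam g) i (densMeasure lam f) =
      fun l => densMeasure lam (if l = i then f else g) := by
    intro i; ext l : 1
    by_cases h : l = i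
    · subst h; simp
    · simp [h]
  have hd : ∀ i l : ι, IsProbDensity lam (if l = i then f else g) := by
    intro i l; split_ifs <;> assumption
  have hi1 := IsProbDensity.integrable_prod_mul (ι := ι) (fun _ => hf) hφ hb
  have hi2 := IsProbDensity.integrable_prod_mul (ι := ι) (fun _ => hg) hφ hb
  have hi3 := fun i => IsProbDensity.integrable_prod_mul (hd i) hφ hb
  simp_rw [hup]
  rw [integral_pi_densMeasure fun _ => hf, integral_pi_densMeasure fun _ => hg]
  simp_rw [fun i => integral_pi_densMeasure (hd i) φ]
  simp_rw [fun i => (integral_sub (hi3 i) hi2).symm]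
  have hi4 : ∀ i, Integrable (fun w : ι → E =>
      (∏ l, (if l = i then f else g) (w l)) * φ w - (∏ l, g (w l)) * φ w)
      (Measure.pi fun _ : ι => lam) := fun i => (hi3 i).sub hi2
  have hi5 : Integrable (fun w : ι → E => (∏ l, f (w l)) * φ w - (∏ l, g (w l)) * φ w)
      (Measure.pi fun _ : ι => lam) := hi1.sub hi2
  rw [← integral_finsetSum _ fun i _ => hi4 i, ← integral_sub hi1 hi2,
    ← integral_sub hi5 (integrable_finsetSum _ fun i _ => hi4 i)]
  have hI : ∀ i j : ι, Integrable (fun w : ι → E => if i = j then 0 else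
      ∏ l, (if l = i ∨ l = j then |f (w l) - g (w l)|
      else f (w l) + g (w l))) (Measure.pi fun _ : ι => lam) := fun i j => by
    split_ifs
    · exact integrable_zero _ _ _
    · exact Integrable.fintype_prod
        (f := fun l x => if l = i ∨ l = j then |f x - g x| else f x + g x)
        fun l => integrable_ite_add hf hg _
  set δ := ∫ x, |f x - g x| ∂lam with hδe
  have hδ : 0 ≤ δ := integral_nonneg fun x => abs_nonneg _
  calc _ ≤ ∫ w : ι → E, ∑ i, ∑ j, (if i = j then 0 else
        ∏ l, (if l = i ∨ l = j then |f (w l) - g (w l)| else f (w l) + g (w l)))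
        ∂Measure.pi (fun _ : ι => lam) := by
        refine (abs_integral_le_integral_abs).trans (integral_mono_of_nonneg
          (ae_of_all _ fun w => abs_nonneg _)
          (integrable_finsetSum _ fun i _ => integrable_finsetSum _ fun j _ => hI i j)
          (ae_of_all _ fun w => ?_))
        simp only
        refine le_trans ?_ (abs_prod_sub_prod_sub_sum_le Finset.univ (fun i => f (w i))
          (fun i => g (w i)) (fun _ => hf.nonneg _) fun _ => hg.nonneg _)
        refine le_trans (le_of_eq ?_) (mul_le_of_le_one_right (abs_nonneg _) (hb w))
        rw [← abs_mul]
        congr 1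
        simp only [sub_mul, Finset.sum_mul]
        congr 1
        refine Finset.sum_congr rfl fun i _ => ?_
        congr 2
        exact Finset.prod_congr rfl fun l _ => by split_ifs <;> rfl
    _ = ∑ i : ι, ∑ j : ι, if i = j then 0 else
        ∏ l, (if l = i ∨ l = j then δ else 2) := by
        rw [integral_finsetSum _ fun i _ => integrable_finsetSum _ fun j _ => hI i j]
        refine Finset.sum_congr rfl fun i _ => ?_
        rw [integral_finsetSum _ fun j _ => hI i j]
        refine Finset.sum_congr rfl fun j _ => ?_
        split_ifs with h
        · simp
        rw [integral_fintype_prod_eq_prod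
          (fun l x => if l = i ∨ l = j then |f x - g x| else f x + g x)]
        exact Finset.prod_congr rfl fun l _ => integral_ite_add_eq hf hg _
    _ ≤ ∑ i : ι, ∑ j : ι, 2 ^ Fintype.card ι * δ ^ 2 := by
        refine Finset.sum_le_sum fun i _ => Finset.sum_le_sum fun j _ => ?_
        split_ifs with hij
        · positivity
        calc _ ≤ ∏ l : ι, (2 * ((if l = i then δ else 1) * (if l = j then δ else 1))) := by
              refine Finset.prod_le_prod (fun l _ => by split_ifs <;> positivity) fun l _ => ?_
              by_cases h1 : l = i
              · have : l ≠ j := fun h => hij (h1 ▸ h)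
                simp [h1, hij]; linarith
              · by_cases h2 : l = j
                · simp [h2, Ne.symm hij]; linarith
                · simp [h1, h2]
          _ = _ := by
              rw [Finset.prod_mul_distrib, Finset.prod_mul_distrib, Finset.prod_ite_eq',
                Finset.prod_ite_eq', if_pos (Finset.mem_univ i), if_pos (Finset.mem_univ j)]
              simp [sq]
    _ = _ := by simp; ring

end Expansion

theorem exists_measurable_fixed_point {α : Type*} [MeasurableSpace α] {K : ℝ} (hK : 0 ≤ K)
    (Φ : (α → ℝ) → α → ℝ)
    (hΦ : ∀ u, Measurable u → (∀ z, u z ∈ Set.Icc 0 K) →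
      Measurable (Φ u) ∧ ∀ z, Φ u z ∈ Set.Icc 0 K)
    (hc : ∀ u v, Measurable u → (∀ z, u z ∈ Set.Icc 0 K) → Measurable v →
      (∀ z, v z ∈ Set.Icc 0 K) → ∀ c, 0 ≤ c → c ≤ K → (∀ z, |u z - v z| ≤ c) →
      ∀ z, |Φ u z - Φ v z| ≤ c / 2) :
    ∃ u, Measurable u ∧ (∀ z, u z ∈ Set.Icc 0 K) ∧ Φ u = u := by
  set u : ℕ → α → ℝ := fun n => Φ^[n] 0 with hu
  have hsucc : ∀ n, u (n + 1) = Φ (u n) := fun n => Function.iterate_succ_apply' Φ n 0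
  have hS : ∀ n, Measurable (u n) ∧ ∀ z, u n z ∈ Set.Icc 0 K := by
    intro n
    induction n with
    | zero => exact ⟨measurable_const, fun z => ⟨le_rfl, hK⟩⟩
    | succ n ih => rw [hsucc]; exact hΦ _ ih.1 ih.2
  have hstep : ∀ n z, |u n z - u (n + 1) z| ≤ K / 2 ^ n := by
    intro n
    induction n with
    | zero =>
      intro z
      have h0 := (hS 0).2 z
      have h1 := (hS 1).2 z
      rw [abs_le]
      constructor <;> simp only [pow_zero, div_one] <;> linarith [h0.1, h0.2, h1.1, h1.2]
    | succ n ih =>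
      intro z
      have := hc _ _ (hS n).1 (hS n).2 (hS (n + 1)).1 (hS (n + 1)).2 (K / 2 ^ n) (by positivity)
        (div_le_self hK (one_le_pow₀ one_le_two)) ih z
      rw [← hsucc, ← hsucc] at this
      refine this.trans_eq ?_
      rw [pow_succ]; field_simp
  have hstep' : ∀ z n, dist (u n z) (u (n + 1) z) ≤ 2 * K / 2 / 2 ^ n := by
    intro z n
    rw [Real.dist_eq]
    refine (hstep n z).trans_eq (by ring)
  choose l hl using fun z => cauchySeq_tendsto_of_complete
    (cauchySeq_of_le_geometric_two (hstep' z))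
  have hlm : Measurable l :=
    measurable_of_tendsto_metrizable (fun n => (hS n).1) (tendsto_pi_nhds.2 hl)
  have hlI : ∀ z, l z ∈ Set.Icc 0 K := fun z =>
    isClosed_Icc.mem_of_tendsto (hl z) (Eventually.of_forall fun n => (hS n).2 z)
  refine ⟨l, hlm, hlI, funext fun z => ?_⟩
  refine tendsto_nhds_unique (f := fun n => u (n + 2) z) ?_
    ((hl z).comp (tendsto_add_atTop_nat 2))
  rw [tendsto_iff_dist_tendsto_zero]
  refine squeeze_zero (fun _ => dist_nonneg) (g := fun n : ℕ => K / 2 * (1 / 2) ^ n)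
    (fun n => ?_) ?_
  · have h1 : ∀ z, |u (n + 1) z - l z| ≤ K / 2 ^ n := fun z => by
      have := dist_le_of_le_geometric_two_of_tendsto (hstep' z) (hl z) (n + 1)
      rw [Real.dist_eq] at this
      refine this.trans_eq ?_
      rw [pow_succ]; field_simp
    have := hc _ _ (hS (n + 1)).1 (hS (n + 1)).2 hlm hlI (K / 2 ^ n) (by positivity)
        (div_le_self hK (one_le_pow₀ one_le_two)) h1 z
    rw [← hsucc] at this
    rw [Real.dist_eq]
    refine this.trans_eq ?_
    rw [div_pow, one_pow]; ring
  · simpa using (tendsto_pow_atTop_nhds_zero_of_lt_one (by norm_num : (0 : ℝ) ≤ 1 / 2)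
      (by norm_num)).const_mul (K / 2)

section Pattern

variable {k : ℕ} (σ : Equiv.Perm (Fin k))

theorem hPat_nonneg (z : Fin k → Ω2) : 0 ≤ hPat σ z := by
  unfold hPat; split_ifs <;> norm_num

theorem hPat_le_one (z : Fin k → Ω2) : hPat σ z ≤ 1 := by
  unfold hPat; split_ifs <;> norm_num

theorem abs_hPat_le_one (z : Fin k → Ω2) : |hPat σ z| ≤ 1 := by
  rw [abs_of_nonneg (hPat_nonneg σ z)]; exact hPat_le_one σ z

theorem measurable_hPat : Measurable (hPat σ) := by
  unfold hPat
  refine Measurable.ite ?_ measurable_const measurable_const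
  have : {z : Fin k → Ω2 | ∃ τ : Equiv.Perm (Fin k),
      StrictMono (fun i => (z (τ i)).1) ∧ StrictMono (fun i => (z (τ (σ⁻¹ i))).2)} =
      ⋃ τ : Equiv.Perm (Fin k), ((⋂ i, ⋂ j, ⋂ _ : i < j, {z | (z (τ i)).1 < (z (τ j)).1}) ∩
        ⋂ i, ⋂ j, ⋂ _ : i < j, {z | (z (τ (σ⁻¹ i))).2 < (z (τ (σ⁻¹ j))).2}) := by
    ext z
    simp [StrictMono]
  rw [this]
  refine MeasurableSet.iUnion fun τ => MeasurableSet.inter ?_ ?_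
  · exact MeasurableSet.iInter fun i => MeasurableSet.iInter fun j => MeasurableSet.iInter fun _ =>
      measurableSet_lt (by fun_prop) (by fun_prop)
  · exact MeasurableSet.iInter fun i => MeasurableSet.iInter fun j => MeasurableSet.iInter fun _ =>
      measurableSet_lt (by fun_prop) (by fun_prop)

/-- The derivative of the pattern density at `P` in the direction of the point mass at `z`. -/
def localField (P : Measure Ω2) (z : Ω2) : ℝ :=
  ∑ i, ∫ w, hPat σ (Function.update w i z) ∂Measure.pi (fun _ : Fin k => P)

variable (P : Measure Ω2) [IsProbabilityMeasure P]

theorem measurable_localField : Measurable (localField σ P) := by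
  refine Finset.measurable_sum _ fun i _ => ?_
  have : StronglyMeasurable fun p : Ω2 × (Fin k → Ω2) => hPat σ (Function.update p.2 i p.1) :=
    ((measurable_hPat σ).comp (measurable_update_prod i)).stronglyMeasurable
  exact this.integral_prod_right'.measurable

theorem integral_hPat_update_mem (i : Fin k) (z : Ω2) :
    ∫ w, hPat σ (Function.update w i z) ∂Measure.pi (fun _ : Fin k => P) ∈ Set.Icc (0 : ℝ) 1 := by
  refine ⟨integral_nonneg fun w => hPat_nonneg σ _, ?_⟩
  refine (integral_mono_of_nonneg (ae_of_all _ fun w => hPat_nonneg σ _) (integrable_const 1)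
    (ae_of_all _ fun w => hPat_le_one σ _)).trans ?_
  simp

theorem localField_mem (z : Ω2) : localField σ P z ∈ Set.Icc (0 : ℝ) k := by
  refine ⟨Finset.sum_nonneg fun i _ => (integral_hPat_update_mem σ P i z).1, ?_⟩
  refine (Finset.sum_le_sum fun i _ => (integral_hPat_update_mem σ P i z).2).trans ?_
  simp

theorem integral_localField (Q : Measure Ω2) [IsProbabilityMeasure Q] :
    ∫ z, localField σ P z ∂Q =
      ∑ i, ∫ w, hPat σ w ∂Measure.pi (Function.update (fun _ : Fin k => P) i Q) := by
  unfold localField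
  have hm : ∀ i, Measurable fun p : Ω2 × (Fin k → Ω2) => hPat σ (Function.update p.2 i p.1) :=
    fun i => (measurable_hPat σ).comp (measurable_update_prod i)
  have hI : ∀ i, Integrable (fun p : Ω2 × (Fin k → Ω2) => hPat σ (Function.update p.2 i p.1))
      (Q.prod (Measure.pi fun _ : Fin k => P)) := fun i =>
    Integrable.of_bound (hm i).aestronglyMeasurable 1 (ae_of_all _ fun p => abs_hPat_le_one σ _)
  rw [integral_finsetSum _ fun i _ => (hI i).integral_prod_left]
  refine Finset.sum_congr rfl fun i _ => ?_
  rw [← map_update_prod_pi, integral_map (measurable_update_prod i).aemeasurable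
    (measurable_hPat σ).aestronglyMeasurable, integral_prod _ (hI i)]

theorem abs_localField_sub_le {lam : Measure Ω2} [SigmaFinite lam] {f g : Ω2 → ℝ}
    (hf : IsProbDensity lam f) (hg : IsProbDensity lam g) (z : Ω2) :
    |localField σ (densMeasure lam f) z - localField σ (densMeasure lam g) z| ≤
      k ^ 2 * 2 ^ k * ∫ x, |f x - g x| ∂lam := by
  unfold localField
  rw [← Finset.sum_sub_distrib]
  refine (Finset.abs_sum_le_sum_abs _ _).trans ((Finset.sum_le_sum fun i _ =>
    abs_integral_pi_sub_le hf hg (φ := fun w => hPat σ (Function.update w i z))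
      ((measurable_hPat σ).comp ((measurable_update_prod i).comp measurable_prodMk_left))
      fun w => abs_hPat_le_one σ _).trans_eq ?_)
  simp only [Finset.sum_const, Finset.card_univ, Fintype.card_fin, nsmul_eq_mul]
  ring

end Pattern

section Tilt

variable {μ : Measure Ω2} [IsProbabilityMeasure μ]

/-- The density proportional to `exp (θ u)` with respect to `μ`. -/
def tiltDens (μ : Measure Ω2) (θ : ℝ) (u : Ω2 → ℝ) (z : Ω2) : ℝ :=
  Real.exp (θ * u z - Real.log (∫ x, Real.exp (θ * u x) ∂μ))

theorem integrable_exp_mul_of_bounded {u : Ω2 → ℝ} (hu : Measurable u) {K : ℝ}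
    (hK : ∀ z, u z ∈ Set.Icc 0 K) (θ : ℝ) : Integrable (fun z => Real.exp (θ * u z)) μ := by
  refine Integrable.of_bound (by fun_prop) (Real.exp (|θ| * K)) (ae_of_all _ fun z => ?_)
  rw [Real.norm_eq_abs, Real.abs_exp]
  refine Real.exp_le_exp.2 ((le_abs_self _).trans ?_)
  rw [abs_mul, abs_of_nonneg (hK z).1]
  exact mul_le_mul_of_nonneg_left (hK z).2 (abs_nonneg θ)

theorem isProbDensity_tiltDens {u : Ω2 → ℝ} (hu : Measurable u) {K : ℝ}
    (hK : ∀ z, u z ∈ Set.Icc 0 K) (θ : ℝ) : IsProbDensity μ (tiltDens μ θ u) := by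
  have hi := integrable_exp_mul_of_bounded (μ := μ) hu hK θ
  have hpos : 0 < ∫ x, Real.exp (θ * u x) ∂μ := integral_exp_pos hi
  have he : tiltDens μ θ u = fun z => Real.exp (θ * u z) / ∫ x, Real.exp (θ * u x) ∂μ := by
    ext z
    rw [tiltDens, Real.exp_sub, Real.exp_log hpos]
  refine ⟨?_, fun z => (Real.exp_pos _).le, ?_, ?_⟩
  · unfold tiltDens; fun_prop
  · rw [he]; exact hi.div_const _
  · rw [he, integral_div, div_self hpos.ne']

theorem integral_abs_tiltDens_sub_le {u v : Ω2 → ℝ} (hu : Measurable u) (hv : Measurable v)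
    {K : ℝ} (hK : ∀ z, u z ∈ Set.Icc 0 K) (hK' : ∀ z, v z ∈ Set.Icc 0 K) {θ c : ℝ}
    (hc : ∀ z, |u z - v z| ≤ c) (hθ : 2 * |θ| * c ≤ 1) :
    ∫ z, |tiltDens μ θ u z - tiltDens μ θ v z| ∂μ ≤ 4 * |θ| * c := by
  have hle : ∀ u v : Ω2 → ℝ, Measurable u → Measurable v → (∀ z, u z ∈ Set.Icc 0 K) →
      (∀ z, v z ∈ Set.Icc 0 K) → (∀ z, |u z - v z| ≤ c) →
      Real.log (∫ x, Real.exp (θ * u x) ∂μ) ≤ |θ| * c + Real.log (∫ x, Real.exp (θ * v x) ∂μ) := by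
    intro u v hu hv hK hK' hc
    have h1 := integrable_exp_mul_of_bounded (μ := μ) hu hK θ
    have h2 := integrable_exp_mul_of_bounded (μ := μ) hv hK' θ
    rw [← Real.log_exp (|θ| * c), ← Real.log_mul (Real.exp_pos _).ne' (integral_exp_pos h2).ne',
      ← integral_const_mul]
    refine Real.log_le_log (integral_exp_pos h1) (integral_mono h1 (h2.const_mul _) fun z => ?_)
    simp only
    rw [← Real.exp_add]
    refine Real.exp_le_exp.2 ?_
    have : θ * u z - θ * v z ≤ |θ| * c := by
      rw [← mul_sub]
      refine (le_abs_self _).trans ?_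
      rw [abs_mul]
      exact mul_le_mul_of_nonneg_left (hc z) (abs_nonneg θ)
    linarith
  have h1 := hle u v hu hv hK hK' hc
  have h2 := hle v u hv hu hK' hK fun z => by rw [abs_sub_comm]; exact hc z
  have hg := isProbDensity_tiltDens (μ := μ) hv hK' θ
  calc _ ≤ ∫ z, tiltDens μ θ v z * (4 * |θ| * c) ∂μ := by
        refine integral_mono_of_nonneg (ae_of_all _ fun z => abs_nonneg _)
          (hg.integrable.mul_const _) (ae_of_all _ fun z => ?_)
        simp only
        set a := θ * u z - Real.log (∫ x, Real.exp (θ * u x) ∂μ) with ha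
        set b := θ * v z - Real.log (∫ x, Real.exp (θ * v x) ∂μ) with hb
        have hab : |a - b| ≤ 2 * |θ| * c := by
          have : |θ * u z - θ * v z| ≤ |θ| * c := by
            rw [← mul_sub, abs_mul]
            exact mul_le_mul_of_nonneg_left (hc z) (abs_nonneg θ)
          rw [abs_le] at this ⊢
          constructor <;> linarith [this.1, this.2]
        have e : tiltDens μ θ u z - tiltDens μ θ v z =
            tiltDens μ θ v z * (Real.exp (a - b) - 1) := by
          simp only [tiltDens]
          rw [← ha, ← hb, mul_sub, ← Real.exp_add]; ring_nf
        rw [e, abs_mul, abs_of_nonneg (hg.nonneg z)]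
        refine mul_le_mul_of_nonneg_left ?_ (hg.nonneg z)
        refine (Real.abs_exp_sub_one_le (hab.trans hθ)).trans ?_
        linarith
    _ = _ := by rw [integral_mul_const, hg.integral_eq, one_mul]

end Tilt

/-- Existence of a solution of the mean-field equation at high temperature. -/
theorem exists_localField_tiltDens_eq {k : ℕ} (σ : Equiv.Perm (Fin k)) (μ : Measure Ω2)
    [IsProbabilityMeasure μ] {θ : ℝ} (hθ : 8 * k ^ 2 * 2 ^ k * |θ| ≤ 1) (hθ' : 2 * |θ| * k ≤ 1) :
    ∃ u : Ω2 → ℝ, Measurable u ∧ (∀ z, u z ∈ Set.Icc (0 : ℝ) k) ∧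
      localField σ (densMeasure μ (tiltDens μ θ u)) = u := by
  refine exists_measurable_fixed_point (Nat.cast_nonneg k)
    (fun u => localField σ (densMeasure μ (tiltDens μ θ u))) (fun u hu hK => ?_) ?_
  · have := (isProbDensity_tiltDens (μ := μ) hu hK θ).isProbabilityMeasure
    exact ⟨measurable_localField σ _, localField_mem σ _⟩
  · intro u v hu hK hv hK' c hc0 hck hc z
    refine (abs_localField_sub_le σ (isProbDensity_tiltDens hu hK θ)
      (isProbDensity_tiltDens hv hK' θ) z).trans ?_
    have h := integral_abs_tiltDens_sub_le (μ := μ) hu hv hK hK' hc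
      ((mul_le_mul_of_nonneg_left hck (by positivity)).trans hθ')
    calc _ ≤ (k : ℝ) ^ 2 * 2 ^ k * (4 * |θ| * c) := by gcongr
      _ = (8 * k ^ 2 * 2 ^ k * |θ|) * (c / 2) := by ring
      _ ≤ 1 * (c / 2) := by gcongr
      _ = c / 2 := one_mul _

theorem entropy_pointwise_bound {f g : ℝ} (hf : 0 ≤ f) (hg : 0 < g) (t : ℝ) :
    2 * t * |f - g| - 2 * t ^ 2 * (f + g) + f * Real.log g + 1 - g ≤
      f * Real.log f + 1 - f := by
  obtain ⟨a, ha, rfl⟩ : ∃ a, 0 ≤ a ∧ f = a ^ 2 :=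
    ⟨√f, Real.sqrt_nonneg f, (Real.sq_sqrt hf).symm⟩
  obtain ⟨b, hb, rfl⟩ : ∃ b, 0 < b ∧ g = b ^ 2 :=
    ⟨√g, Real.sqrt_pos.2 hg, (Real.sq_sqrt hg.le).symm⟩
  have hlog : a ^ 2 * Real.log (b ^ 2) + 2 * a ^ 2 - 2 * a * b ≤ a ^ 2 * Real.log (a ^ 2) := by
    rcases ha.eq_or_lt with rfl | ha
    · simp
    · have h := Real.log_le_sub_one_of_pos (div_pos hb ha)
      rw [Real.log_div hb.ne' ha.ne'] at h
      rw [Real.log_pow, Real.log_pow]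
      have h2 := mul_le_mul_of_nonneg_left h (by positivity : 0 ≤ 2 * a ^ 2)
      have h3 : 2 * a ^ 2 * (b / a - 1) = 2 * a * b - 2 * a ^ 2 := by field_simp
      push_cast
      nlinarith
  have habs : |a ^ 2 - b ^ 2| = |a - b| * (a + b) := by
    rw [sq_sub_sq, abs_mul, abs_of_nonneg (by positivity : 0 ≤ a + b), mul_comm]
  rw [habs]
  nlinarith [sq_nonneg (|a - b| - t * (a + b)), sq_nonneg (t * (a - b)), sq_abs (a - b)]

theorem KL_densMeasure {μ : Measure Ω2} [IsProbabilityMeasure μ] {f : Ω2 → ℝ}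
    (hf : IsProbDensity μ f) :
    KL (densMeasure μ f) μ =
      ∫⁻ z, ENNReal.ofReal (f z * Real.log (f z) + 1 - f z) ∂μ := by
  rw [KL, if_pos (show densMeasure μ f ≪ μ from withDensity_absolutelyContinuous _ _)]
  have h := Measure.rnDeriv_withDensity μ hf.measurable.ennreal_ofReal
  refine lintegral_congr_ae ?_
  filter_upwards [h] with z hz
  rw [densMeasure, hz, ENNReal.toReal_ofReal (hf.nonneg z)]

theorem entropy_integrand_nonneg {f : ℝ} (hf : 0 ≤ f) : 0 ≤ f * Real.log f + 1 - f := by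
  have := entropy_pointwise_bound hf one_pos 0
  simp at this; linarith

theorem exists_isProbDensity_of_KL_ne_top {μ ν : Measure Ω2} [IsProbabilityMeasure μ]
    [IsProbabilityMeasure ν] (h : KL ν μ ≠ ∞) :
    ∃ f, IsProbDensity μ f ∧ ν = densMeasure μ f ∧
      Integrable (fun z => f z * Real.log (f z) + 1 - f z) μ := by
  have hac : ν ≪ μ := by
    by_contra hac
    exact h (if_neg hac)
  have hden : ν = densMeasure μ fun z => (ν.rnDeriv μ z).toReal := by
    conv_lhs => rw [← Measure.withDensity_rnDeriv_eq ν μ hac]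
    refine withDensity_congr_ae ?_
    filter_upwards [ν.rnDeriv_ne_top μ] with z hz
    rw [ENNReal.ofReal_toReal hz]
  have hf : IsProbDensity μ fun z => (ν.rnDeriv μ z).toReal := by
    refine ⟨(Measure.measurable_rnDeriv ν μ).ennreal_toReal, fun _ => ENNReal.toReal_nonneg,
      Measure.integrable_toReal_rnDeriv, ?_⟩
    rw [Measure.integral_toReal_rnDeriv hac]; simp
  refine ⟨_, hf, hden, ?_⟩
  rw [hden, KL_densMeasure hf] at h
  refine (lintegral_ofReal_ne_top_iff_integrable ?_ (ae_of_all _ fun z => ?_)).1 h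
  · have := hf.measurable
    exact (((this.mul (Real.measurable_log.comp this)).add_const 1).sub this).aestronglyMeasurable
  · exact entropy_integrand_nonneg (hf.nonneg z)

/-- A Pinsker-type lower bound for the entropy of `f` relative to a reference density `g`. -/
theorem entropy_lower_bound {μ : Measure Ω2} [IsProbabilityMeasure μ] {f g : Ω2 → ℝ}
    (hf : IsProbDensity μ f) (hg : IsProbDensity μ g) (hg0 : ∀ z, 0 < g z)
    (hfi : Integrable (fun z => f z * Real.log (f z) + 1 - f z) μ)
    (hfg : Integrable (fun z => f z * Real.log (g z)) μ) :
    (∫ z, |f z - g z| ∂μ) ^ 2 / 4 + ∫ z, f z * Real.log (g z) ∂μ ≤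
      ∫ z, (f z * Real.log (f z) + 1 - f z) ∂μ := by
  set δ := ∫ z, |f z - g z| ∂μ with hδ
  set t := δ / 4 with ht
  have hd : Integrable (fun z => |f z - g z|) μ := (hf.integrable.sub hg.integrable).abs
  have hlow : Integrable (fun z => 2 * t * |f z - g z| - 2 * t ^ 2 * (f z + g z) +
      f z * Real.log (g z) + 1 - g z) μ :=
    ((((hd.const_mul _).sub ((hf.integrable.add hg.integrable).const_mul _)).add hfg).add
      (integrable_const 1)).sub hg.integrable
  have h := integral_mono hlow hfi fun z =>
    entropy_pointwise_bound (hf.nonneg z) (hg0 z) t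
  refine le_trans (le_of_eq ?_) h
  have e : ∀ z, 2 * t * |f z - g z| - 2 * t ^ 2 * (f z + g z) +
      f z * Real.log (g z) + 1 - g z = 2 * t * |f z - g z| - (2 * t ^ 2) * f z -
        (2 * t ^ 2 + 1) * g z + f z * Real.log (g z) + 1 := fun z => by ring
  have i1 : Integrable (fun z => 2 * t * |f z - g z|) μ := hd.const_mul _
  have i2 : Integrable (fun z => 2 * t ^ 2 * f z) μ := hf.integrable.const_mul _
  have i3 : Integrable (fun z => (2 * t ^ 2 + 1) * g z) μ := hg.integrable.const_mul _
  have i12 : Integrable (fun z => 2 * t * |f z - g z| - 2 * t ^ 2 * f z) μ := i1.sub i2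
  have i123 : Integrable (fun z => 2 * t * |f z - g z| - 2 * t ^ 2 * f z -
    (2 * t ^ 2 + 1) * g z) μ := i12.sub i3
  have i4 : Integrable (fun z => 2 * t * |f z - g z| - 2 * t ^ 2 * f z -
    (2 * t ^ 2 + 1) * g z + f z * Real.log (g z)) μ := i123.add hfg
  simp_rw [e]
  rw [integral_add i4 (integrable_const 1), integral_add i123 hfg, integral_sub i12 i3,
    integral_sub i1 i2, integral_const_mul, integral_const_mul, integral_const_mul,
    hf.integral_eq, hg.integral_eq, ← hδ]
  simp only [integral_const, probReal_univ, smul_eq_mul, ht]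
  ring

theorem mem_Mcal_of_absolutelyContinuous {μ ν : ProbabilityMeasure Ω2} (hμ : μ ∈ Mcal)
    (h : (ν : Measure Ω2) ≪ μ) : ν ∈ Mcal := by
  obtain ⟨h1, h2, h3⟩ := hμ
  have hsq : MeasurableSet unitSq := measurableSet_Icc.prod measurableSet_Icc
  refine ⟨?_, fun x => (h.map measurable_fst) (h2 x), fun y => (h.map measurable_snd) (h3 y)⟩
  exact (prob_compl_eq_zero_iff hsq).1 (h ((prob_compl_eq_zero_iff hsq).2 h1))

theorem log_tiltDens {μ : Measure Ω2} (θ : ℝ) (u : Ω2 → ℝ) (z : Ω2) :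
    Real.log (tiltDens μ θ u z) = θ * u z - Real.log (∫ x, Real.exp (θ * u x) ∂μ) :=
  Real.log_exp _

/-- A solution of the mean-field equation is the unique maximizer at high temperature. -/
theorem Fset_eq_singleton {k : ℕ} (σ : Equiv.Perm (Fin k)) {μ ν : ProbabilityMeasure Ω2}
    (hμ : μ ∈ Mcal) {θ : ℝ} (hθ : 8 * k ^ 2 * 2 ^ k * |θ| ≤ 1) {u : Ω2 → ℝ} (hu : Measurable u)
    (hK : ∀ z, u z ∈ Set.Icc (0 : ℝ) k)
    (hν : (ν : Measure Ω2) = densMeasure μ (tiltDens μ θ u))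
    (hfix : localField σ (ν : Measure Ω2) = u) : Fset σ (μ : Measure Ω2) θ = {ν} := by
  set g := tiltDens (μ : Measure Ω2) θ u with hgdef
  set c := Real.log (∫ x, Real.exp (θ * u x) ∂(μ : Measure Ω2)) with hc
  have hg : IsProbDensity (μ : Measure Ω2) g := isProbDensity_tiltDens hu hK θ
  have hlog : ∀ z, Real.log (g z) = θ * u z - c := log_tiltDens θ u
  have hνM : ν ∈ Mcal := by
    refine mem_Mcal_of_absolutelyContinuous hμ ?_
    rw [hν]; exact withDensity_absolutelyContinuous _ _
  have hub : ∀ z, |u z| ≤ k := fun z => by rw [abs_of_nonneg (hK z).1]; exact (hK z).2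
  have hfu : ∀ f, IsProbDensity (μ : Measure Ω2) f →
      Integrable (fun z => f z * u z) (μ : Measure Ω2) := fun f hf =>
    hf.integrable.mul_bdd (c := (k : ℝ)) hu.aestronglyMeasurable (ae_of_all _ hub)
  have hflog : ∀ f, IsProbDensity (μ : Measure Ω2) f →
      Integrable (fun z => f z * Real.log (g z)) (μ : Measure Ω2) := fun f hf => by
    simp_rw [hlog, mul_sub]
    have h1 : Integrable (fun z => f z * (θ * u z)) (μ : Measure Ω2) := by
      simpa only [mul_left_comm] using (hfu f hf).const_mul θ
    exact h1.sub (hf.integrable.mul_const c)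
  have hfint : ∀ f, IsProbDensity (μ : Measure Ω2) f →
      ∫ z, f z * Real.log (g z) ∂(μ : Measure Ω2) =
        θ * ∫ z, u z ∂densMeasure μ f - c := fun f hf => by
    rw [integral_densMeasure hf.measurable hf.nonneg]
    simp_rw [hlog, mul_sub]
    have h1 : Integrable (fun z => f z * (θ * u z)) (μ : Measure Ω2) := by
      simpa only [mul_left_comm] using (hfu f hf).const_mul θ
    rw [integral_sub h1 (hf.integrable.mul_const c), integral_mul_const, hf.integral_eq, one_mul,
      ← integral_const_mul]
    simp only [mul_left_comm]
  have hgi : Integrable (fun z => g z * Real.log (g z) + 1 - g z) (μ : Measure Ω2) :=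
    ((hflog g hg).add (integrable_const 1)).sub hg.integrable
  have hgE : ∫ z, (g z * Real.log (g z) + 1 - g z) ∂(μ : Measure Ω2) =
      ∫ z, g z * Real.log (g z) ∂(μ : Measure Ω2) := by
    have h1 : Integrable (fun z => g z * Real.log (g z) + 1) (μ : Measure Ω2) :=
      (hflog g hg).add (integrable_const 1)
    rw [integral_sub h1 hg.integrable, integral_add (hflog g hg) (integrable_const 1),
      hg.integral_eq]
    simp
  have hKL : ∀ f, IsProbDensity (μ : Measure Ω2) f →
      Integrable (fun z => f z * Real.log (f z) + 1 - f z) (μ : Measure Ω2) →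
      ((KL (densMeasure μ f) μ : ℝ≥0∞) : EReal) =
        ((∫ z, (f z * Real.log (f z) + 1 - f z) ∂(μ : Measure Ω2) : ℝ) : EReal) := by
    intro f hf hfi
    have hn : ∀ z, 0 ≤ f z * Real.log (f z) + 1 - f z := fun z =>
      entropy_integrand_nonneg (hf.nonneg z)
    rw [KL_densMeasure hf, ← ofReal_integral_eq_lintegral_ofReal hfi (ae_of_all _ hn),
      EReal.coe_ennreal_ofReal, max_eq_left (integral_nonneg hn)]
  have key : ∀ f, IsProbDensity (μ : Measure Ω2) f →
      Integrable (fun z => f z * Real.log (f z) + 1 - f z) (μ : Measure Ω2) →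
      θ * tPat σ (densMeasure μ f) - ∫ z, (f z * Real.log (f z) + 1 - f z) ∂(μ : Measure Ω2) +
          (∫ z, |f z - g z| ∂(μ : Measure Ω2)) ^ 2 / 8 ≤
        θ * tPat σ (ν : Measure Ω2) -
          ∫ z, (g z * Real.log (g z) + 1 - g z) ∂(μ : Measure Ω2) := by
    intro f hf hfi
    have := hf.isProbabilityMeasure
    have h1 := entropy_lower_bound hf hg (fun z => Real.exp_pos _) hfi (hflog f hf)
    have h2 := abs_integral_pi_sub_sub_sum_le hf hg (measurable_hPat σ) (abs_hPat_le_one σ)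
    rw [Finset.sum_sub_distrib, ← hν, ← integral_localField, hfix, Fintype.card_fin] at h2
    have h3 : ∑ _i : Fin k, ∫ w, hPat σ w ∂Measure.pi (fun _ : Fin k => (ν : Measure Ω2)) =
        ∫ z, u z ∂(ν : Measure Ω2) := by
      rw [← congrArg (fun v => ∫ z, v z ∂(ν : Measure Ω2)) hfix, integral_localField]
      simp
    rw [h3] at h2
    rw [hgE, hfint g hg, ← hν]
    rw [hfint f hf] at h1
    set δ := ∫ z, |f z - g z| ∂(μ : Measure Ω2)
    set Δ := tPat σ (densMeasure μ f) - tPat σ (ν : Measure Ω2) -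
      (∫ z, u z ∂densMeasure μ f - ∫ z, u z ∂(ν : Measure Ω2)) with hΔ
    have h4 : θ * Δ ≤ δ ^ 2 / 8 := by
      calc θ * Δ ≤ |θ| * |Δ| := by rw [← abs_mul]; exact le_abs_self _
        _ ≤ |θ| * (k ^ 2 * 2 ^ k * δ ^ 2) := mul_le_mul_of_nonneg_left h2 (abs_nonneg θ)
        _ = (8 * k ^ 2 * 2 ^ k * |θ|) * (δ ^ 2 / 8) := by ring
        _ ≤ 1 * (δ ^ 2 / 8) := by gcongr
        _ = _ := one_mul _
    rw [hΔ] at h4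
    linarith
  have hval : ∀ ρ ∈ Mcal, ρ = ν ∨
      (((θ * tPat σ (ρ : Measure Ω2) : ℝ) : EReal) - ((KL (↑ρ) μ : ℝ≥0∞) : EReal)) <
      (((θ * tPat σ (ν : Measure Ω2) : ℝ) : EReal) - ((KL (↑ν) μ : ℝ≥0∞) : EReal)) := by
    intro ρ _
    have hνval : ((θ * tPat σ (ν : Measure Ω2) : ℝ) : EReal) - ((KL (↑ν) μ : ℝ≥0∞) : EReal) =
        ((θ * tPat σ (ν : Measure Ω2) -
          ∫ z, (g z * Real.log (g z) + 1 - g z) ∂(μ : Measure Ω2) : ℝ) : EReal) := by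
      rw [congrArg (fun x => KL x (μ : Measure Ω2)) hν, hKL g hg hgi, ← EReal.coe_sub]
    rw [hνval]
    by_cases htop : KL (ρ : Measure Ω2) μ = ∞
    · right
      rw [htop, EReal.coe_ennreal_top, EReal.sub_top]
      exact EReal.bot_lt_coe _
    obtain ⟨f, hf, hρ, hfi⟩ := exists_isProbDensity_of_KL_ne_top htop
    by_cases hδ : ∫ z, |f z - g z| ∂(μ : Measure Ω2) = 0
    · left
      have hd : Integrable (fun z => |f z - g z|) (μ : Measure Ω2) :=
        (hf.integrable.sub hg.integrable).abs
      rw [integral_eq_zero_iff_of_nonneg (fun z => abs_nonneg _) hd] at hδ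
      apply Subtype.ext
      change (ρ : Measure Ω2) = (ν : Measure Ω2)
      rw [hρ, hν]
      refine withDensity_congr_ae ?_
      filter_upwards [hδ] with z hz
      rw [sub_eq_zero.1 (abs_eq_zero.1 hz)]
    · right
      rw [hρ, hKL f hf hfi, ← EReal.coe_sub, EReal.coe_lt_coe_iff]
      have h1 := key f hf hfi
      have h2 : 0 < (∫ z, |f z - g z| ∂(μ : Measure Ω2)) ^ 2 / 8 := by positivity
      linarith
  have hsup : Fsup σ (μ : Measure Ω2) θ =
      ((θ * tPat σ (ν : Measure Ω2) : ℝ) : EReal) - ((KL (↑ν) μ : ℝ≥0∞) : EReal) := by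
    refine le_antisymm (iSup₂_le fun ρ hρ => ?_) (le_iSup₂_of_le ν hνM le_rfl)
    rcases hval ρ hρ with rfl | h
    · exact le_rfl
    · exact h.le
  ext ρ
  rw [Set.mem_singleton_iff]
  constructor
  · rintro ⟨hρ, he⟩
    exact (hval ρ hρ).resolve_right (by rw [he, hsup]; exact lt_irrefl _)
  · rintro rfl
    exact ⟨hνM, hsup.symm⟩

section Empirical

variable {n k : ℕ}

/-- The empirical measure of `n` points. -/
def empM (z : Fin n → Ω2) : Measure Ω2 := (n : ℝ≥0∞)⁻¹ • ∑ i : Fin n, Measure.dirac (z i)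

theorem isProbabilityMeasure_empM (hn : n ≠ 0) (z : Fin n → Ω2) :
    IsProbabilityMeasure (empM z) := by
  constructor
  simp only [empM, Measure.smul_apply, Measure.coe_finsetSum, Finset.sum_apply,
    measure_univ, Finset.sum_const, Finset.card_univ, Fintype.card_fin, nsmul_eq_mul, mul_one,
    smul_eq_mul]
  exact ENNReal.inv_mul_cancel (by exact_mod_cast hn) (ENNReal.natCast_ne_top n)

theorem integral_empM (z : Fin n → Ω2) (φ : Ω2 → ℝ) :
    ∫ x, φ x ∂empM z = (n : ℝ)⁻¹ * ∑ i, φ (z i) := by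
  rw [empM, integral_smul_measure, integral_finsetSum_measure fun i _ =>
    integrable_dirac (by finiteness)]
  simp [integral_dirac]

open scoped Classical in
theorem toReal_empM (z : Fin n → Ω2) {s : Set Ω2} (hs : MeasurableSet s) :
    (empM z s).toReal = (n : ℝ)⁻¹ * (Finset.univ.filter fun i => z i ∈ s).card := by
  rw [empM]
  simp only [Measure.smul_apply, Measure.coe_finsetSum, Finset.sum_apply,
    Measure.dirac_apply' _ hs, Set.indicator_apply, smul_eq_mul, ENNReal.toReal_mul,
    Pi.one_apply, ENNReal.toReal_inv, ENNReal.toReal_natCast]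
  rw [Finset.sum_boole, ENNReal.toReal_natCast]

theorem empM_comp_perm (z : Fin n → Ω2) (τ : Equiv.Perm (Fin n)) : empM (z ∘ τ) = empM z := by
  rw [empM, empM, ← Equiv.sum_comp τ fun i => Measure.dirac (z i)]
  rfl

theorem hPat_congr (σ : Equiv.Perm (Fin k)) {z z' : Fin k → Ω2}
    (h1 : ∀ i j, (z i).1 < (z j).1 ↔ (z' i).1 < (z' j).1)
    (h2 : ∀ i j, (z i).2 < (z j).2 ↔ (z' i).2 < (z' j).2) : hPat σ z = hPat σ z' := by
  unfold hPat StrictMono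
  simp only [h1, h2]

theorem tPat_empM_eq_sum (σ : Equiv.Perm (Fin k)) (hn : n ≠ 0) (z : Fin n → Ω2) :
    tPat σ (empM z) = ∫ w, hPat σ (fun i => z (w i))
      ∂Measure.pi fun _ : Fin k => (n : ℝ≥0∞)⁻¹ • (Measure.count : Measure (Fin n)) := by
  have hz : Measurable z := measurable_of_finite z
  have hmap : empM z = ((n : ℝ≥0∞)⁻¹ • (Measure.count : Measure (Fin n))).map z := by
    rw [Measure.map_smul, empM, Measure.count, Measure.sum_fintype, ← Measure.mapₗ_apply_of_measurable hz,
      map_sum]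
    simp only [Measure.mapₗ_apply_of_measurable hz, Measure.map_dirac' hz]
  have := isProbabilityMeasure_empM hn z
  have hfin : IsFiniteMeasure ((n : ℝ≥0∞)⁻¹ • (Measure.count : Measure (Fin n))) :=
    Measure.smul_finite _ (by simp [hn])
  rw [tPat, hmap]
  have hs : SigmaFinite (((n : ℝ≥0∞)⁻¹ • (Measure.count : Measure (Fin n))).map z) := by
    rw [← hmap]; infer_instance
  rw [← Measure.pi_map_pi (fun _ => hz.aemeasurable), integral_map]
  · exact (measurable_pi_lambda _ fun i => hz.comp (measurable_pi_apply i)).aemeasurable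
  · exact (measurable_hPat σ).aestronglyMeasurable

theorem tPat_empM_congr (σ : Equiv.Perm (Fin k)) (hn : n ≠ 0) {z z' : Fin n → Ω2}
    (h1 : ∀ i j, (z i).1 < (z j).1 ↔ (z' i).1 < (z' j).1)
    (h2 : ∀ i j, (z i).2 < (z j).2 ↔ (z' i).2 < (z' j).2) :
    tPat σ (empM z) = tPat σ (empM z') := by
  rw [tPat_empM_eq_sum σ hn, tPat_empM_eq_sum σ hn]
  congr 1
  ext w
  exact hPat_congr σ (fun i j => h1 _ _) fun i j => h2 _ _

/-- Points in generic position: no coordinate is repeated. -/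
def GenericPts (z : Fin n → Ω2) : Prop :=
  Function.Injective (fun i => (z i).1) ∧ Function.Injective fun i => (z i).2

theorem GenericPts.exists_hPat_eq_one {z : Fin n → Ω2} (h : GenericPts z) :
    ∃ σ : Equiv.Perm (Fin n), hPat σ z = 1 := by
  set τ₁ := Tuple.sort fun i => (z i).1
  set τ₂ := Tuple.sort fun i => (z i).2
  refine ⟨τ₂⁻¹ * τ₁, if_pos ⟨τ₁, ?_, ?_⟩⟩
  · exact (Tuple.monotone_sort fun i => (z i).1).strictMono_of_injective
      (h.1.comp τ₁.injective)
  · have := (Tuple.monotone_sort fun i => (z i).2).strictMono_of_injective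
      (h.2.comp τ₂.injective)
    simpa [Function.comp_def] using this

theorem GenericPts.exists_sorting {z : Fin n → Ω2} (h : GenericPts z) :
    ∃ τ : Equiv.Perm (Fin n), (∀ i j, (z (τ i)).1 < (z (τ j)).1 ↔ i < j) ∧
      ∀ i j, (z (τ i)).2 < (z (τ j)).2 ↔ inducedPerm z i < inducedPerm z j := by
  have h1 := h.exists_hPat_eq_one
  have h2 : hPat (inducedPerm z) z = 1 := by
    rw [inducedPerm, dif_pos h1]; exact h1.choose_spec
  rw [hPat] at h2
  split_ifs at h2 with h3
  · obtain ⟨τ, hx, hy⟩ := h3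
    refine ⟨τ, fun i j => hx.lt_iff_lt, fun i j => ?_⟩
    have := hy.lt_iff_lt (a := inducedPerm z i) (b := inducedPerm z j)
    simpa using this
  · norm_num at h2

theorem EmM_eq_empM (π : Equiv.Perm (Fin n)) :
    EmM π = empM fun i : Fin n => (((i : ℕ) + 1 : ℝ) / n, ((π i : ℕ) + 1 : ℝ) / n) := rfl

theorem GenericPts.tPerm_inducedPerm (σ : Equiv.Perm (Fin k)) (hn : n ≠ 0) {z : Fin n → Ω2}
    (h : GenericPts z) : tPerm σ (inducedPerm z) = tPat σ (empM z) := by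
  obtain ⟨τ, h1, h2⟩ := h.exists_sorting
  have hn' : (0 : ℝ) < n := by positivity
  rw [tPerm, EmM_eq_empM, ← empM_comp_perm z τ]
  refine tPat_empM_congr σ hn (fun i j => ?_) fun i j => ?_
  · rw [Function.comp, Function.comp, h1, div_lt_div_iff_of_pos_right hn']
    simp
  · rw [Function.comp, Function.comp, h2, div_lt_div_iff_of_pos_right hn']
    simp

theorem GenericPts.EmM_inducedPerm {z : Fin n → Ω2} (h : GenericPts z) :
    EmM (inducedPerm z) = empM fun i => (cdfX (empM z) (z i).1, cdfY (empM z) (z i).2) := by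
  classical
  obtain ⟨τ, h1, h2⟩ := h.exists_sorting
  rw [EmM_eq_empM, ← empM_comp_perm (fun i => (cdfX (empM z) (z i).1, cdfY (empM z) (z i).2)) τ]
  congr 1
  ext i
  · simp only [Function.comp, cdfX]
    rw [toReal_empM _ (measurableSet_le measurable_fst measurable_const), inv_mul_eq_div]
    congr 1
    have : (Finset.univ.filter fun j => z j ∈ {p : Ω2 | p.1 ≤ (z (τ i)).1}) =
        (Finset.Iic i).map τ.toEmbedding := by
      ext j
      obtain ⟨j, rfl⟩ := τ.surjective j
      have : (z (τ j)).1 ≤ (z (τ i)).1 ↔ j ≤ i := by rw [← not_lt, h1, not_lt]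
      simp [this]
    rw [this, Finset.card_map, Fin.card_Iic]
    push_cast; rfl
  · simp only [Function.comp, cdfY]
    rw [toReal_empM _ (measurableSet_le measurable_snd measurable_const), inv_mul_eq_div]
    congr 1
    have : (Finset.univ.filter fun j => z j ∈ {p : Ω2 | p.2 ≤ (z (τ i)).2}) =
        (Finset.Iic (inducedPerm z i)).map ((inducedPerm z).symm.trans τ).toEmbedding := by
      ext j
      obtain ⟨j, rfl⟩ := τ.surjective j
      have : (z (τ j)).2 ≤ (z (τ i)).2 ↔ inducedPerm z j ≤ inducedPerm z i := by
        rw [← not_lt, h2, not_lt]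
      simp [this, Equiv.symm_apply_eq]
    rw [this, Finset.card_map, Fin.card_Iic]
    push_cast; rfl

theorem ae_genericPts {μ : ProbabilityMeasure Ω2} (hμ : μ ∈ Mcal) (n : ℕ) :
    ∀ᵐ z ∂pmeas (μ : Measure Ω2) n, GenericPts z := by
  have key : ∀ f : Ω2 → ℝ, Measurable f → (∀ x, (μ : Measure Ω2).map f {x} = 0) →
      ∀ᵐ z ∂pmeas (μ : Measure Ω2) n, Function.Injective fun i => f (z i) := by
    intro f hf h0
    have h1 : ∀ i j : Fin n, i ≠ j → ∀ᵐ z ∂pmeas (μ : Measure Ω2) n, f (z i) ≠ f (z j) := by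
      intro i j hij
      have hs : MeasurableSet {z : Fin n → Ω2 | f (z i) = f (z j)} :=
        measurableSet_eq_fun (by fun_prop) (by fun_prop)
      rw [ae_iff]
      simp only [ne_eq, not_not]
      have h2 := map_update_prod_pi (fun _ : Fin n => (μ : Measure Ω2)) (μ : Measure Ω2) i
      rw [Function.update_eq_self] at h2
      rw [pmeas, ← h2, Measure.map_apply (measurable_update_prod i) hs,
        Measure.measure_prod_null (measurable_update_prod i hs)]
      refine Eventually.of_forall fun x => ?_
      have h3 := (measurePreserving_eval (fun _ : Fin n => (μ : Measure Ω2)) j).measure_preimage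
        (s := f ⁻¹' {f x}) (hf (measurableSet_singleton _)).nullMeasurableSet
      rw [← Measure.map_apply hf (measurableSet_singleton _), h0] at h3
      simp only [Pi.zero_apply]
      rw [← h3]
      congr 1
      ext w
      simp [Function.update_of_ne hij.symm, eq_comm]
    have h2 : ∀ᵐ z ∂pmeas (μ : Measure Ω2) n, ∀ i j : Fin n, i ≠ j → f (z i) ≠ f (z j) := by
      refine ae_all_iff.2 fun i => ae_all_iff.2 fun j => ?_
      by_cases hij : i = j
      · simp [hij]
      · filter_upwards [h1 i j hij] with z hz _ using hz
    filter_upwards [h2] with z hz i j hij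
    by_contra hne
    exact hz i j hne hij
  filter_upwards [key _ measurable_fst hμ.2.1, key _ measurable_snd hμ.2.2] with z h1 h2
  exact ⟨h1, h2⟩

end Empirical

theorem continuous_cdf_of_noAtoms (P : Measure ℝ) [IsProbabilityMeasure P] (h0 : ∀ x, P {x} = 0) :
    Continuous (ProbabilityTheory.cdf P) := by
  refine continuous_iff_continuousAt.2 fun x => ?_
  rw [(ProbabilityTheory.cdf P).mono.continuousAt_iff_leftLim_eq_rightLim,
    StieltjesFunction.rightLim_eq]
  have h := (ProbabilityTheory.cdf P).measure_singleton x
  rw [ProbabilityTheory.measure_cdf, h0, eq_comm, ENNReal.ofReal_eq_zero] at h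
  exact le_antisymm ((ProbabilityTheory.cdf P).mono.leftLim_le le_rfl) (by linarith)

theorem exists_cdf_eq (P : Measure ℝ) [IsProbabilityMeasure P] (h0 : ∀ x, P {x} = 0) {t : ℝ}
    (ht0 : 0 < t) (ht1 : t < 1) : ∃ q, ProbabilityTheory.cdf P q = t := by
  have hc := continuous_cdf_of_noAtoms P h0
  obtain ⟨a, ha⟩ := ((ProbabilityTheory.tendsto_cdf_atBot P).eventually (eventually_le_nhds ht0)).exists
  obtain ⟨b, hb⟩ := ((ProbabilityTheory.tendsto_cdf_atTop P).eventually (eventually_ge_nhds ht1)).exists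
  exact mem_range_of_exists_le_of_exists_ge hc ⟨a, ha⟩ ⟨b, hb⟩

theorem le_measureReal_cdf_lt (P : Measure ℝ) [IsProbabilityMeasure P] (h0 : ∀ x, P {x} = 0)
    {t : ℝ} (ht1 : t ≤ 1) : t ≤ P.real {x | ProbabilityTheory.cdf P x < t} := by
  refine le_of_forall_lt fun s hs => ?_
  rcases le_or_gt 0 s with hs0 | hs0
  · obtain ⟨q, hq⟩ := exists_cdf_eq P h0 (t := (s + t) / 2) (by linarith) (by linarith)
    have : P.real (Set.Iic q) ≤ P.real {x | ProbabilityTheory.cdf P x < t} :=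
      measureReal_mono fun x (hx : x ≤ q) =>
        lt_of_le_of_lt ((ProbabilityTheory.cdf P).mono hx) (by linarith)
    rw [← ProbabilityTheory.cdf_eq_real, hq] at this
    linarith
  · exact hs0.trans_le measureReal_nonneg

theorem measureReal_cdf_le_le (P : Measure ℝ) [IsProbabilityMeasure P] (h0 : ∀ x, P {x} = 0)
    {t : ℝ} (ht0 : 0 ≤ t) : P.real {x | ProbabilityTheory.cdf P x ≤ t} ≤ t := by
  refine le_of_forall_gt fun s hs => ?_
  rcases lt_or_ge 1 s with hs1 | hs1
  · exact lt_of_le_of_lt measureReal_le_one hs1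
  · obtain ⟨q, hq⟩ := exists_cdf_eq P h0 (t := (s + t) / 2) (by linarith) (by linarith)
    have : P.real {x | ProbabilityTheory.cdf P x ≤ t} ≤ P.real (Set.Iic q) := by
      refine measureReal_mono fun x (hx : _ ≤ t) => ?_
      by_contra hxq
      have := (ProbabilityTheory.cdf P).mono (not_le.1 hxq).le
      linarith
    rw [← ProbabilityTheory.cdf_eq_real, hq] at this
    linarith

/-- Cutting the line into `m + 1` consecutive cells of mass at most `1 / m`. -/
theorem exists_coarsening (P : Measure ℝ) [IsProbabilityMeasure P] (h0 : ∀ x, P {x} = 0) {m : ℕ}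
    (hm : 0 < m) :
    ∃ α : ℝ → Fin (m + 1), Measurable α ∧ Monotone α ∧
      (∀ x, ((α x : ℕ) : ℝ) ≤ m * ProbabilityTheory.cdf P x ∧
        m * ProbabilityTheory.cdf P x ≤ (α x : ℕ) + 1) ∧
      ∀ c, P.real (α ⁻¹' {c}) ≤ 1 / m := by
  have hm' : (0 : ℝ) < m := by exact_mod_cast hm
  have hG0 : ∀ x, 0 ≤ m * ProbabilityTheory.cdf P x := fun x =>
    mul_nonneg hm'.le (ProbabilityTheory.cdf_nonneg P x)
  have hlt : ∀ x, ⌊m * ProbabilityTheory.cdf P x⌋₊ < m + 1 := fun x => by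
    rw [Nat.lt_succ_iff]
    refine Nat.floor_le_of_le ?_
    exact mul_le_of_le_one_right hm'.le (ProbabilityTheory.cdf_le_one P x)
  have hmeas : Measurable (ProbabilityTheory.cdf P) := (ProbabilityTheory.cdf P).mono.measurable
  have hbd : ∀ x, (⌊m * ProbabilityTheory.cdf P x⌋₊ : ℝ) ≤ m * ProbabilityTheory.cdf P x ∧
        m * ProbabilityTheory.cdf P x ≤ ⌊m * ProbabilityTheory.cdf P x⌋₊ + 1 := fun x =>
    ⟨Nat.floor_le (hG0 x), (Nat.lt_floor_add_one _).le⟩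
  refine ⟨fun x => ⟨_, hlt x⟩, ?_, fun x y hxy => ?_, hbd, fun c => ?_⟩
  · refine measurable_to_countable' fun c => ?_
    have : (fun x => (⟨_, hlt x⟩ : Fin (m + 1))) ⁻¹' {c} =
        (fun x => ⌊m * ProbabilityTheory.cdf P x⌋₊) ⁻¹' {(c : ℕ)} := by
      ext x; simp [Fin.ext_iff]
    rw [this]
    exact (Nat.measurable_floor.comp (hmeas.const_mul _)) (measurableSet_singleton _)
  · exact Fin.mk_le_mk.2 (Nat.floor_mono
      (mul_le_mul_of_nonneg_left ((ProbabilityTheory.cdf P).mono hxy) hm'.le))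
  · have hsub : (fun x => (⟨_, hlt x⟩ : Fin (m + 1))) ⁻¹' {c} ⊆
        {x | ProbabilityTheory.cdf P x ≤ ((c : ℕ) + 1) / m} \
          {x | ProbabilityTheory.cdf P x < (c : ℕ) / m} := by
      intro x hx
      have hx' : ⌊m * ProbabilityTheory.cdf P x⌋₊ = (c : ℕ) := congrArg Fin.val hx
      have := hbd x
      rw [hx'] at this
      rw [Set.mem_sdiff, Set.mem_ofPred_eq, Set.mem_ofPred_eq, not_lt]
      rw [le_div_iff₀ hm', div_le_iff₀ hm', mul_comm]
      exact this.symm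
    refine (measureReal_mono hsub).trans ?_
    have hle : {x | ProbabilityTheory.cdf P x < (c : ℕ) / m} ⊆
        {x | ProbabilityTheory.cdf P x ≤ ((c : ℕ) + 1) / m} := by
      intro x hx
      have hx' : ProbabilityTheory.cdf P x < (c : ℕ) / m := hx
      refine hx'.le.trans ?_
      gcongr
      linarith
    rw [measureReal_sdiff hle (measurableSet_lt hmeas measurable_const)]
    have h1 := measureReal_cdf_le_le P h0 (t := ((c : ℕ) + 1) / m) (by positivity)
    have h2 := le_measureReal_cdf_lt P h0 (t := (c : ℕ) / m) (by
      rw [div_le_one hm']; exact_mod_cast Nat.lt_succ_iff.1 c.2)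
    have h3 : ((c : ℕ) + 1 : ℝ) / m = (c : ℕ) / m + 1 / m := add_div _ _ _
    linarith

section Collision

variable {ι E γ : Type*} [Fintype ι] [DecidableEq ι] [MeasurableSpace E] [MeasurableSpace γ]
  [DiscreteMeasurableSpace γ] [Countable γ]

theorem pi_real_eq_le (M : ι → Measure E) [∀ i, IsProbabilityMeasure (M i)] {i j : ι}
    (hij : i ≠ j) {g : E → γ} (hg : Measurable g) {b : ℝ} (hb0 : 0 ≤ b)
    (hb : ∀ c, (M i).real (g ⁻¹' {c}) ≤ b) :
    (Measure.pi M).real {w | g (w i) = g (w j)} ≤ b := by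
  have hs : MeasurableSet {w : ι → E | g (w i) = g (w j)} :=
    measurableSet_eq_fun (by fun_prop) (by fun_prop)
  have h2 := map_update_prod_pi M (M i) i
  rw [Function.update_eq_self] at h2
  rw [measureReal_def, ← h2, Measure.map_apply (measurable_update_prod i) hs,
    Measure.prod_apply_symm (measurable_update_prod i hs)]
  refine ENNReal.toReal_le_of_le_ofReal hb0 ?_
  calc _ ≤ ∫⁻ _, ENNReal.ofReal b ∂Measure.pi M := lintegral_mono fun w => ?_
    _ = ENNReal.ofReal b := by simp
  rw [ENNReal.le_ofReal_iff_toReal_le (measure_ne_top _ _) hb0]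
  refine le_trans (le_of_eq ?_) (hb (g (w j)))
  rw [measureReal_def]
  congr 2
  ext x
  simp [Function.update_of_ne hij.symm]

end Collision

section Discrete

variable {I : Type*} [Fintype I] [MeasurableSpace I] [MeasurableSingletonClass I]

theorem isProbDensity_count (Q : Measure I) [IsProbabilityMeasure Q] :
    IsProbDensity Measure.count (fun a => Q.real {a}) := by
  refine ⟨measurable_of_countable _, fun a => measureReal_nonneg, Integrable.of_finite, ?_⟩
  rw [integral_count]
  have h := sum_measureReal_singleton (μ := Q) Finset.univ
  rw [h, Finset.coe_univ, probReal_univ]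

theorem densMeasure_count (Q : Measure I) [IsProbabilityMeasure Q] :
    densMeasure Measure.count (fun a => Q.real {a}) = Q := by
  refine Measure.ext_of_singleton fun a => ?_
  rw [densMeasure, withDensity_apply _ (measurableSet_singleton a), Measure.restrict_singleton,
    Measure.count_singleton, one_smul, lintegral_dirac, measureReal_def,
    ENNReal.ofReal_toReal (measure_ne_top _ _)]

end Discrete

section Grid

variable {k m : ℕ}

/-- A point of the integer grid, seen in the plane. -/
def gridPt (a : Fin (m + 1) × Fin (m + 1)) : Ω2 := (((a.1 : ℕ) : ℝ), ((a.2 : ℕ) : ℝ))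

/-- The cell of a point, given the column and row maps. -/
def gridMap (α β : ℝ → Fin (m + 1)) (z : Ω2) : Fin (m + 1) × Fin (m + 1) := (α z.1, β z.2)

theorem measurable_gridMap {α β : ℝ → Fin (m + 1)} (hα : Measurable α) (hβ : Measurable β) :
    Measurable (gridMap α β) :=
  (hα.comp measurable_fst).prodMk (hβ.comp measurable_snd)

/-- The cell configurations with two points in the same column or the same row. -/
def collisionSet (k m : ℕ) : Set (Fin k → Fin (m + 1) × Fin (m + 1)) :=
  {a | ∃ i j, i ≠ j ∧ ((a i).1 = (a j).1 ∨ (a i).2 = (a j).2)}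

/-- The indicator of a collision. -/
def collision (a : Fin k → Fin (m + 1) × Fin (m + 1)) : ℝ := (collisionSet k m).indicator 1 a

theorem abs_collision_le_one (a : Fin k → Fin (m + 1) × Fin (m + 1)) : |collision a| ≤ 1 := by
  unfold collision Set.indicator; split_ifs <;> simp

theorem abs_hPat_sub_gridMap_le (σ : Equiv.Perm (Fin k)) {α β : ℝ → Fin (m + 1)}
    (hα : Monotone α) (hβ : Monotone β) (w : Fin k → Ω2) :
    |hPat σ w - hPat σ (fun i => gridPt (gridMap α β (w i)))| ≤
      collision fun i => gridMap α β (w i) := by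
  by_cases hc : (fun i => gridMap α β (w i)) ∈ collisionSet k m
  · rw [collision, Set.indicator_of_mem hc, Pi.one_apply, abs_le]
    have h1 := hPat_nonneg σ w
    have h2 := hPat_le_one σ w
    have h3 := hPat_nonneg σ (fun i => gridPt (gridMap α β (w i)))
    have h4 := hPat_le_one σ (fun i => gridPt (gridMap α β (w i)))
    constructor <;> linarith
  · rw [collision, Set.indicator_of_notMem hc, hPat_congr σ (z := w)
      (z' := fun i => gridPt (gridMap α β (w i))), sub_self, abs_zero]
    · intro i j
      simp only [gridPt, gridMap, Nat.cast_lt, Fin.val_fin_lt]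
      refine ⟨fun h => lt_of_le_of_ne (hα h.le) fun he => hc ⟨i, j, ?_, Or.inl he⟩,
        fun h => hα.reflect_lt h⟩
      rintro rfl; exact lt_irrefl _ h
    · intro i j
      simp only [gridPt, gridMap, Nat.cast_lt, Fin.val_fin_lt]
      refine ⟨fun h => lt_of_le_of_ne (hβ h.le) fun he => hc ⟨i, j, ?_, Or.inr he⟩,
        fun h => hβ.reflect_lt h⟩
      rintro rfl; exact lt_irrefl _ h

theorem integral_collision_le (M : Fin k → Measure (Fin (m + 1) × Fin (m + 1)))
    [∀ i, IsProbabilityMeasure (M i)] {P : Measure (Fin (m + 1) × Fin (m + 1))}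
    (hM : ∀ i j, i ≠ j → M i = P ∨ M j = P) {b : ℝ} (hb : 0 ≤ b)
    (h1 : ∀ c, P.real (Prod.fst ⁻¹' {c}) ≤ b) (h2 : ∀ c, P.real (Prod.snd ⁻¹' {c}) ≤ b) :
    ∫ a, collision a ∂Measure.pi M ≤ 2 * k ^ 2 * b := by
  have key : ∀ g : Fin (m + 1) × Fin (m + 1) → Fin (m + 1), (∀ c, P.real (g ⁻¹' {c}) ≤ b) →
      ∀ i j, i ≠ j → (Measure.pi M).real {w | g (w i) = g (w j)} ≤ b := by
    intro g hg i j hij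
    rcases hM i j hij with h | h
    · exact pi_real_eq_le M hij (measurable_of_countable g) hb (by rw [h]; exact hg)
    · have := pi_real_eq_le M hij.symm (measurable_of_countable g) hb (by rw [h]; exact hg)
      simpa only [eq_comm] using this
  have hsub : collisionSet k m ⊆ ⋃ p ∈ (Finset.univ : Finset (Fin k × Fin k)).filter
      (fun p => p.1 ≠ p.2), ({w | (w p.1).1 = (w p.2).1} ∪ {w | (w p.1).2 = (w p.2).2}) := by
    rintro a ⟨i, j, hij, h⟩
    simp only [Set.mem_iUnion]
    exact ⟨(i, j), by simpa using hij, h⟩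
  have hint : ∫ a, collision a ∂Measure.pi M = (Measure.pi M).real (collisionSet k m) := by
    unfold collision
    rw [integral_indicator_one (Set.toFinite _).measurableSet]
  rw [hint]
  refine (measureReal_mono hsub (measure_ne_top _ _)).trans ((measureReal_biUnion_finset_le _ _).trans ?_)
  have : ∀ p ∈ (Finset.univ : Finset (Fin k × Fin k)).filter (fun p => p.1 ≠ p.2),
      (Measure.pi M).real ({w | (w p.1).1 = (w p.2).1} ∪ {w | (w p.1).2 = (w p.2).2}) ≤ 2 * b := by
    intro p hp
    have hp' : p.1 ≠ p.2 := by simpa using hp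
    refine (measureReal_union_le _ _).trans ?_
    have := key Prod.fst h1 p.1 p.2 hp'
    have := key Prod.snd h2 p.1 p.2 hp'
    linarith
  refine (Finset.sum_le_card_nsmul _ _ _ this).trans ?_
  rw [nsmul_eq_mul]
  have hcard : ((Finset.univ : Finset (Fin k × Fin k)).filter (fun p => p.1 ≠ p.2)).card ≤ k ^ 2 :=
    (Finset.card_filter_le _ _).trans (by simp [sq])
  have : ((((Finset.univ : Finset (Fin k × Fin k)).filter (fun p => p.1 ≠ p.2)).card : ℕ) : ℝ) ≤
    k ^ 2 := by exact_mod_cast hcard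
  nlinarith

theorem abs_integral_hPat_sub_gridMap_le (σ : Equiv.Perm (Fin k)) {α β : ℝ → Fin (m + 1)}
    (hα : Monotone α) (hβ : Monotone β) (hα' : Measurable α) (hβ' : Measurable β)
    (M : Fin k → Measure Ω2) [∀ i, IsProbabilityMeasure (M i)] :
    |∫ w, hPat σ w ∂Measure.pi M -
        ∫ a, hPat σ (fun i => gridPt (a i)) ∂Measure.pi (fun i => (M i).map (gridMap α β))| ≤
      ∫ a, collision a ∂Measure.pi (fun i => (M i).map (gridMap α β)) := by
  have hκ := measurable_gridMap hα' hβ'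
  have := fun i => Measure.isProbabilityMeasure_map (μ := M i) hκ.aemeasurable
  have hm : Measurable fun (w : Fin k → Ω2) i => gridMap α β (w i) :=
    measurable_pi_lambda _ fun i => hκ.comp (measurable_pi_apply i)
  rw [← Measure.pi_map_pi (fun _ => hκ.aemeasurable),
    integral_map hm.aemeasurable (measurable_of_countable _).aestronglyMeasurable,
    integral_map hm.aemeasurable (measurable_of_countable _).aestronglyMeasurable,
    ← integral_sub]
  · refine (abs_integral_le_integral_abs).trans (integral_mono_of_nonneg
      (ae_of_all _ fun _ => abs_nonneg _) ?_ (ae_of_all _ fun w =>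
        abs_hPat_sub_gridMap_le σ hα hβ w))
    exact Integrable.of_bound ((measurable_of_countable _).comp hm).aestronglyMeasurable 1
      (ae_of_all _ fun w => abs_collision_le_one _)
  · exact Integrable.of_bound (measurable_hPat σ).aestronglyMeasurable 1
      (ae_of_all _ fun w => abs_hPat_le_one σ _)
  · exact Integrable.of_bound ((measurable_of_countable
      fun a : Fin k → Fin (m + 1) × Fin (m + 1) => hPat σ (fun i => gridPt (a i))).comp
      hm).aestronglyMeasurable 1 (ae_of_all _ fun w => abs_hPat_le_one σ _)

end Grid

section GridDev

variable {k m : ℕ}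

/-- The total deviation between the cell masses of two measures. -/
def gridDev (α β : ℝ → Fin (m + 1)) (ν L : Measure Ω2) : ℝ :=
  ∑ a, |L.real (gridMap α β ⁻¹' {a}) - ν.real (gridMap α β ⁻¹' {a})|

theorem gridDev_nonneg (α β : ℝ → Fin (m + 1)) (ν L : Measure Ω2) : 0 ≤ gridDev α β ν L :=
  Finset.sum_nonneg fun _ _ => abs_nonneg _

theorem abs_tPat_sub_sub_localField_le (σ : Equiv.Perm (Fin k)) {α β : ℝ → Fin (m + 1)}
    (hα : Monotone α) (hβ : Monotone β) (hα' : Measurable α) (hβ' : Measurable β)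
    (ν L : Measure Ω2) [IsProbabilityMeasure ν] [IsProbabilityMeasure L] {b : ℝ} (hb : 0 ≤ b)
    (h1 : ∀ c, ν.real ((fun z => α z.1) ⁻¹' {c}) ≤ b)
    (h2 : ∀ c, ν.real ((fun z => β z.2) ⁻¹' {c}) ≤ b) :
    |tPat σ L - tPat σ ν - (∫ z, localField σ ν z ∂L - ∫ z, localField σ ν z ∂ν)| ≤
      2 * k ^ 2 * 2 ^ k * gridDev α β ν L ^ 2 + (6 * k ^ 3 + 4 * k ^ 2) * b := by
  have hκ := measurable_gridMap hα' hβ'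
  set P := ν.map (gridMap α β) with hP
  set Q := L.map (gridMap α β) with hQ
  have : IsProbabilityMeasure P := Measure.isProbabilityMeasure_map hκ.aemeasurable
  have : IsProbabilityMeasure Q := Measure.isProbabilityMeasure_map hκ.aemeasurable
  have hup : ∀ i j, IsProbabilityMeasure (Function.update (fun _ : Fin k => ν) i L j) := by
    intro i j; by_cases h : j = i
    · subst h; simpa
    · simpa [Function.update_of_ne h]
  have hup' : ∀ i j, IsProbabilityMeasure (Function.update (fun _ : Fin k => P) i Q j) := by
    intro i j; by_cases h : j = i
    · subst h; simpa
    · simpa [Function.update_of_ne h]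
  have hmapup : ∀ i, (fun j => (Function.update (fun _ : Fin k => ν) i L j).map (gridMap α β)) =
      Function.update (fun _ : Fin k => P) i Q := by
    intro i; ext1 j; by_cases h : j = i
    · subst h; simp [hQ]
    · simp [Function.update_of_ne h, hP]
  have hP1 : ∀ c, P.real (Prod.fst ⁻¹' {c}) ≤ b := fun c => by
    rw [hP, map_measureReal_apply hκ (Set.toFinite _).measurableSet]; exact h1 c
  have hP2 : ∀ c, P.real (Prod.snd ⁻¹' {c}) ≤ b := fun c => by
    rw [hP, map_measureReal_apply hκ (Set.toFinite _).measurableSet]; exact h2 c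
  have hdev : ∫ a, |Q.real {a} - P.real {a}| ∂Measure.count = gridDev α β ν L := by
    rw [integral_count, gridDev]
    refine Finset.sum_congr rfl fun a _ => ?_
    rw [hP, hQ, map_measureReal_apply hκ (measurableSet_singleton a),
      map_measureReal_apply hκ (measurableSet_singleton a)]
  have taylor : ∀ φ : (Fin k → Fin (m + 1) × Fin (m + 1)) → ℝ, (∀ a, |φ a| ≤ 1) →
      |∫ a, φ a ∂Measure.pi (fun _ : Fin k => Q) - ∫ a, φ a ∂Measure.pi (fun _ : Fin k => P) -
        ∑ i, (∫ a, φ a ∂Measure.pi (Function.update (fun _ : Fin k => P) i Q) -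
          ∫ a, φ a ∂Measure.pi (fun _ : Fin k => P))| ≤
        k ^ 2 * 2 ^ k * gridDev α β ν L ^ 2 := by
    intro φ hφ
    have := abs_integral_pi_sub_sub_sum_le (ι := Fin k) (isProbDensity_count Q)
      (isProbDensity_count P) (measurable_of_countable φ) hφ
    rw [densMeasure_count, densMeasure_count, hdev, Fintype.card_fin] at this
    exact this
  have hcP : ∫ a, collision a ∂Measure.pi (fun _ : Fin k => P) ≤ 2 * k ^ 2 * b :=
    integral_collision_le _ (fun _ _ _ => Or.inl rfl) hb hP1 hP2
  have hcP0 : 0 ≤ ∫ a, collision a ∂Measure.pi (fun _ : Fin k => P) :=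
    integral_nonneg fun a => Set.indicator_nonneg (fun _ _ => zero_le_one) a
  have hcU : ∀ i, ∫ a, collision a ∂Measure.pi (Function.update (fun _ : Fin k => P) i Q) ≤
      2 * k ^ 2 * b := fun i =>
    integral_collision_le _ (fun j l hjl => by
      by_cases h : j = i
      · right; rw [Function.update_of_ne (by rintro rfl; exact hjl h)]
      · left; rw [Function.update_of_ne h]) hb hP1 hP2
  have hcQ : ∫ a, collision a ∂Measure.pi (fun _ : Fin k => Q) ≤
      k ^ 2 * 2 ^ k * gridDev α β ν L ^ 2 + (1 + k) * (2 * k ^ 2 * b) := by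
    have h3 := (abs_le.1 (taylor collision abs_collision_le_one)).2
    have h4 : ∑ i : Fin k, (∫ a, collision a ∂Measure.pi (Function.update (fun _ : Fin k => P) i Q) -
        ∫ a, collision a ∂Measure.pi (fun _ : Fin k => P)) ≤ ∑ _i : Fin k, 2 * k ^ 2 * b :=
      Finset.sum_le_sum fun i _ => by linarith [hcU i]
    rw [Finset.sum_const, Finset.card_univ, Fintype.card_fin, nsmul_eq_mul] at h4
    linarith
  have gQ := (abs_integral_hPat_sub_gridMap_le σ hα hβ hα' hβ' fun _ => L).trans hcQ
  have gP := (abs_integral_hPat_sub_gridMap_le σ hα hβ hα' hβ' fun _ => ν).trans hcP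
  have gU : ∀ i, |∫ w, hPat σ w ∂Measure.pi (Function.update (fun _ => ν) i L) -
      ∫ a, hPat σ (fun i => gridPt (a i)) ∂Measure.pi (Function.update (fun _ => P) i Q)| ≤
      2 * k ^ 2 * b := fun i => by
    have := abs_integral_hPat_sub_gridMap_le σ hα hβ hα' hβ' (Function.update (fun _ => ν) i L)
    rw [hmapup i] at this
    exact this.trans (hcU i)
  have main := taylor (fun a => hPat σ fun i => gridPt (a i)) fun a => abs_hPat_le_one σ _
  have hself : ∫ z, localField σ ν z ∂ν = ∑ _i : Fin k, tPat σ ν := by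
    rw [integral_localField]; simp [tPat]
  rw [integral_localField, hself, ← Finset.sum_sub_distrib]
  have hsum : |∑ i : Fin k, (∫ w, hPat σ w ∂Measure.pi (Function.update (fun _ => ν) i L) -
        tPat σ ν) -
      ∑ i, (∫ a, hPat σ (fun i => gridPt (a i)) ∂Measure.pi
          (Function.update (fun _ : Fin k => P) i Q) -
        ∫ a, hPat σ (fun i => gridPt (a i)) ∂Measure.pi (fun _ : Fin k => P))| ≤
      ∑ _i : Fin k, 4 * k ^ 2 * b := by
    rw [← Finset.sum_sub_distrib]
    refine (Finset.abs_sum_le_sum_abs _ _).trans (Finset.sum_le_sum fun i _ => ?_)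
    have e1 := abs_le.1 (gU i)
    have e2 := abs_le.1 gP
    rw [abs_le]
    unfold tPat
    constructor <;> linarith [e1.1, e1.2, e2.1, e2.2]
  rw [Finset.sum_const, Finset.card_univ, Fintype.card_fin, nsmul_eq_mul] at hsum
  have e1 := abs_le.1 gQ
  have e2 := abs_le.1 gP
  have e3 := abs_le.1 hsum
  have e4 := abs_le.1 main
  unfold tPat at e3 ⊢
  rw [abs_le]
  constructor <;> nlinarith [e1.1, e1.2, e2.1, e2.2, e3.1, e3.2, e4.1, e4.2]

end GridDev

section Concentration

theorem integral_exp_sum_le (ν : Measure Ω2) [IsProbabilityMeasure ν] {g : Ω2 → ℝ}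
    (hg : Measurable g) (hb : ∀ z, g z ∈ Set.Icc (-1 : ℝ) 1) (n : ℕ) (l : ℝ) :
    ∫ z, Real.exp (l * ∑ i, (g (z i) - ∫ x, g x ∂ν)) ∂pmeas ν n ≤ Real.exp (n * (l ^ 2 / 2)) := by
  have h := ProbabilityTheory.hasSubgaussianMGF_of_mem_Icc hg.aemeasurable (ae_of_all ν hb)
  have h1 := h.mgf_le l
  have hc : ((‖(1 : ℝ) - -1‖₊ / 2) ^ 2 : NNReal) = 1 := by
    have : ‖(1 : ℝ) - -1‖₊ = 2 := by
      ext; norm_num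
    rw [this]; norm_num
  rw [hc, NNReal.coe_one, one_mul, ProbabilityTheory.mgf] at h1
  simp_rw [Finset.mul_sum, Real.exp_sum]
  rw [pmeas, integral_fintype_prod_eq_pow (fun x => Real.exp (l * (g x - ∫ x, g x ∂ν))),
    Fintype.card_fin, Real.exp_nat_mul]
  exact pow_le_pow_left₀ (integral_nonneg fun _ => (Real.exp_pos _).le) h1 n

variable {m n : ℕ} {α β : ℝ → Fin (m + 1)}

/-- The function equal to `1` on the cells of `s` and to `-1` elsewhere. -/
def cellSign (α β : ℝ → Fin (m + 1)) (s : Finset (Fin (m + 1) × Fin (m + 1))) (z : Ω2) : ℝ :=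
  if gridMap α β z ∈ s then 1 else -1

theorem cellSign_mem (s : Finset (Fin (m + 1) × Fin (m + 1))) (z : Ω2) :
    cellSign α β s z ∈ Set.Icc (-1 : ℝ) 1 := by
  unfold cellSign; split_ifs <;> norm_num

theorem measurable_cellSign (hα : Measurable α) (hβ : Measurable β)
    (s : Finset (Fin (m + 1) × Fin (m + 1))) : Measurable (cellSign α β s) :=
  (measurable_of_countable fun a => if a ∈ s then (1 : ℝ) else -1).comp (measurable_gridMap hα hβ)

theorem abs_integral_cellSign_le (s : Finset (Fin (m + 1) × Fin (m + 1))) (P : Measure Ω2)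
    [IsProbabilityMeasure P] : |∫ z, cellSign α β s z ∂P| ≤ 1 := by
  have := norm_integral_le_of_norm_le_const (μ := P) (f := cellSign α β s) (C := 1)
    (ae_of_all _ fun z => abs_le.2 (cellSign_mem s z))
  simpa using this

theorem exists_gridDev_eq (hα : Measurable α) (hβ : Measurable β) (ν L : Measure Ω2)
    [IsProbabilityMeasure ν] [IsProbabilityMeasure L] :
    ∃ s, gridDev α β ν L = ∫ z, cellSign α β s z ∂L - ∫ z, cellSign α β s z ∂ν := by
  have hκ := measurable_gridMap hα hβ
  have hint : ∀ (s) (P : Measure Ω2) [IsProbabilityMeasure P],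
      ∫ z, cellSign α β s z ∂P =
        ∑ a, P.real (gridMap α β ⁻¹' {a}) * if a ∈ s then 1 else -1 := by
    intro s P _
    have := Measure.isProbabilityMeasure_map (μ := P) hκ.aemeasurable
    have h := integral_map (μ := P) hκ.aemeasurable (measurable_of_countable
      fun a => if a ∈ s then (1 : ℝ) else -1).aestronglyMeasurable
    unfold cellSign
    rw [← h, integral_fintype Integrable.of_finite]
    refine Finset.sum_congr rfl fun a _ => ?_
    rw [map_measureReal_apply hκ (measurableSet_singleton a), smul_eq_mul]
  refine ⟨Finset.univ.filter fun a =>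
    ν.real (gridMap α β ⁻¹' {a}) ≤ L.real (gridMap α β ⁻¹' {a}), ?_⟩
  rw [hint, hint, ← Finset.sum_sub_distrib, gridDev]
  refine Finset.sum_congr rfl fun a _ => ?_
  simp only [Finset.mem_filter, Finset.mem_univ, true_and]
  split_ifs with h
  · rw [abs_of_nonneg (by linarith)]; ring
  · rw [abs_of_neg (by linarith)]; ring

theorem gridDev_le_two (hα : Measurable α) (hβ : Measurable β) (ν L : Measure Ω2)
    [IsProbabilityMeasure ν] [IsProbabilityMeasure L] : gridDev α β ν L ≤ 2 := by
  obtain ⟨s, hs⟩ := exists_gridDev_eq hα hβ ν L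
  rw [hs]
  linarith [(abs_le.1 (abs_integral_cellSign_le (α := α) (β := β) s L)).2,
    (abs_le.1 (abs_integral_cellSign_le (α := α) (β := β) s ν)).1]

theorem measurable_gridDev (hα : Measurable α) (hβ : Measurable β) (ν : Measure Ω2) :
    Measurable fun z : Fin n → Ω2 => gridDev α β ν (empM z) := by
  classical
  have hκ := measurable_gridMap hα hβ
  unfold gridDev
  refine Finset.measurable_sum _ fun a _ => (Measurable.sub_const ?_ _).abs
  have hs := hκ (measurableSet_singleton a)
  have : (fun z : Fin n → Ω2 => (empM z).real (gridMap α β ⁻¹' {a})) = fun z =>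
      (n : ℝ)⁻¹ * ∑ i, (gridMap α β ⁻¹' {a}).indicator (fun _ => (1 : ℝ)) (z i) := by
    ext z
    rw [← integral_empM, integral_indicator hs]
    simp
  rw [this]
  refine Measurable.const_mul (Finset.measurable_sum _ fun i _ => ?_) _
  exact (measurable_const.indicator hs).comp (measurable_pi_apply i)

theorem integrable_exp_gridDev (hα : Measurable α) (hβ : Measurable β) (ν : Measure Ω2)
    [IsProbabilityMeasure ν] (hn : n ≠ 0) (c : ℝ) :
    Integrable (fun z => Real.exp (c * gridDev α β ν (empM z) ^ 2)) (pmeas ν n) := by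
  have : IsProbabilityMeasure (pmeas ν n) := by unfold pmeas; infer_instance
  refine Integrable.of_bound (((measurable_gridDev hα hβ ν).pow_const 2).const_mul
    c).exp.aestronglyMeasurable (Real.exp (|c| * 2 ^ 2)) (ae_of_all _ fun z => ?_)
  have := isProbabilityMeasure_empM hn z
  rw [Real.norm_eq_abs, Real.abs_exp]
  gcongr
  · exact le_abs_self c
  · exact gridDev_nonneg α β ν _
  · exact gridDev_le_two hα hβ ν _

theorem integral_exp_gridDev_le (hα : Measurable α) (hβ : Measurable β) (ν : Measure Ω2)
    [IsProbabilityMeasure ν] (hn : n ≠ 0) :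
    ∫ z, Real.exp (n / 2 * gridDev α β ν (empM z) ^ 2) ∂pmeas ν n ≤
      3 * (2 * n + 1) * 2 ^ ((m + 1) ^ 2) := by
  have hn' : (0 : ℝ) < n := by positivity
  have : IsProbabilityMeasure (pmeas ν n) := by unfold pmeas; infer_instance
  set Y : Finset (Fin (m + 1) × Fin (m + 1)) → (Fin n → Ω2) → ℝ := fun s z =>
    ∑ i, (cellSign α β s (z i) - ∫ x, cellSign α β s x ∂ν) with hY
  have hYb : ∀ s z, |Y s z| ≤ 2 * n := by
    intro s z
    refine (Finset.abs_sum_le_sum_abs _ _).trans ((Finset.sum_le_card_nsmul _ _ 2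
      fun i _ => ?_).trans_eq ?_)
    · have h1 := cellSign_mem (α := α) (β := β) s (z i)
      have h2 := abs_le.1 (abs_integral_cellSign_le (α := α) (β := β) s ν)
      rw [abs_le]
      constructor <;> linarith [h1.1, h1.2, h2.1, h2.2]
    · simp [mul_comm]
  have hYm : ∀ s, Measurable (Y s) := fun s =>
    Finset.measurable_sum _ fun i _ =>
      ((measurable_cellSign hα hβ s).comp (measurable_pi_apply i)).sub_const _
  have hpt : ∀ z : Fin n → Ω2, Real.exp (n / 2 * gridDev α β ν (empM z) ^ 2) ≤
      ∑ s, ∑ j ∈ Finset.range (2 * n + 1),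
        3 * (Real.exp (-(n * ((j / n : ℝ) ^ 2 / 2))) * Real.exp ((j / n : ℝ) * Y s z)) := by
    intro z
    have := isProbabilityMeasure_empM hn z
    obtain ⟨s, hs⟩ := exists_gridDev_eq hα hβ ν (empM z)
    have h0 := gridDev_nonneg α β ν (empM z)
    have h2 := gridDev_le_two hα hβ ν (empM z)
    set D := gridDev α β ν (empM z)
    have hDY : Y s z = n * D := by
      rw [hs, integral_empM]
      simp only [hY]
      rw [Finset.sum_sub_distrib, Finset.sum_const, Finset.card_univ, Fintype.card_fin,
        nsmul_eq_mul]
      field_simp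
    have hj1 := Nat.floor_le (mul_nonneg hn'.le h0)
    have hj2 := Nat.lt_floor_add_one (n * D)
    have hj : ⌊n * D⌋₊ ∈ Finset.range (2 * n + 1) := by
      rw [Finset.mem_range, Nat.lt_succ_iff]
      refine Nat.floor_le_of_le ?_
      push_cast; nlinarith
    set j := ⌊n * D⌋₊
    have hnn : ∀ s (j : ℕ), 0 ≤ 3 * (Real.exp (-(n * ((j / n : ℝ) ^ 2 / 2))) *
        Real.exp ((j / n : ℝ) * Y s z)) := fun s j => by positivity
    refine le_trans ?_ (Finset.single_le_sum (f := fun s => ∑ j ∈ Finset.range (2 * n + 1),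
      3 * (Real.exp (-(n * ((j / n : ℝ) ^ 2 / 2))) * Real.exp ((j / n : ℝ) * Y s z)))
      (fun s _ => Finset.sum_nonneg fun j _ => hnn s j) (Finset.mem_univ s))
    refine le_trans ?_ (Finset.single_le_sum (f := fun j : ℕ =>
      3 * (Real.exp (-(n * ((j / n : ℝ) ^ 2 / 2))) * Real.exp ((j / n : ℝ) * Y s z)))
      (fun j _ => hnn s j) hj)
    rw [hDY, ← Real.exp_add]
    have h3 : Real.exp 1 ≤ 3 := by linarith [Real.exp_one_lt_d9]
    calc Real.exp (n / 2 * D ^ 2)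
        ≤ Real.exp (1 + (-(n * ((j / n : ℝ) ^ 2 / 2)) + (j / n : ℝ) * (n * D))) := by
          refine Real.exp_le_exp.2 ?_
          have hn1 : (1 : ℝ) ≤ n := by exact_mod_cast Nat.one_le_iff_ne_zero.2 hn
          have e : 1 + (-(n * ((j / n : ℝ) ^ 2 / 2)) + (j / n : ℝ) * (n * D)) - n / 2 * D ^ 2 =
            (2 * n - (n * D - j) ^ 2) / (2 * n) := by field_simp; ring
          have : 0 ≤ (2 * n - (n * D - j) ^ 2) / (2 * n) := by
            apply div_nonneg _ (by positivity)
            nlinarith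
          linarith
      _ = Real.exp 1 * _ := Real.exp_add _ _
      _ ≤ _ := by gcongr
  have hint : ∀ s (j : ℕ), Integrable (fun z => 3 * (Real.exp (-(n * ((j / n : ℝ) ^ 2 / 2))) *
      Real.exp ((j / n : ℝ) * Y s z))) (pmeas ν n) := by
    intro s j
    refine Integrable.const_mul (Integrable.const_mul ?_ _) _
    refine Integrable.of_bound ((hYm s).const_mul _).exp.aestronglyMeasurable
      (Real.exp ((j / n : ℝ) * (2 * n))) (ae_of_all _ fun z => ?_)
    rw [Real.norm_eq_abs, Real.abs_exp]
    gcongr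
    exact (le_abs_self _).trans (hYb s z)
  refine (integral_mono (integrable_exp_gridDev hα hβ ν hn _)
    (integrable_finsetSum _ fun s _ => integrable_finsetSum _ fun j _ => hint s j) hpt).trans ?_
  rw [integral_finsetSum _ fun s _ => integrable_finsetSum _ fun j _ => hint s j]
  calc _ ≤ ∑ _s : Finset (Fin (m + 1) × Fin (m + 1)),
      ∑ _j ∈ Finset.range (2 * n + 1), (3 : ℝ) := ?_
    _ = _ := by simp [sq]; ring
  refine Finset.sum_le_sum fun s _ => ?_
  rw [integral_finsetSum _ fun j _ => hint s j]
  refine Finset.sum_le_sum fun j _ => ?_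
  rw [integral_const_mul, integral_const_mul]
  have := integral_exp_sum_le ν (measurable_cellSign hα hβ s) (cellSign_mem s) n (j / n : ℝ)
  calc _ ≤ 3 * (Real.exp (-(n * ((j / n : ℝ) ^ 2 / 2))) * Real.exp (n * ((j / n : ℝ) ^ 2 / 2))) := by
        gcongr
    _ = 3 := by rw [← Real.exp_add]; simp

end Concentration

section ChangeOfMeasure

variable {k n : ℕ} (σ : Equiv.Perm (Fin k))

theorem tPat_mem (P : Measure Ω2) [IsProbabilityMeasure P] : tPat σ P ∈ Set.Icc (0 : ℝ) 1 := by
  refine ⟨integral_nonneg fun w => hPat_nonneg σ w, ?_⟩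
  refine (integral_mono_of_nonneg (ae_of_all _ fun w => hPat_nonneg σ w) (integrable_const 1)
    (ae_of_all _ fun w => hPat_le_one σ w)).trans ?_
  simp

theorem measurable_tPat_empM (hn : n ≠ 0) :
    Measurable fun z : Fin n → Ω2 => tPat σ (empM z) := by
  have hfin : IsFiniteMeasure ((n : ℝ≥0∞)⁻¹ • (Measure.count : Measure (Fin n))) :=
    Measure.smul_finite _ (by simp [hn])
  simp_rw [tPat_empM_eq_sum σ hn]
  have : ∀ z : Fin n → Ω2, Integrable (fun w : Fin k → Fin n => hPat σ fun i => z (w i))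
      (Measure.pi fun _ : Fin k => (n : ℝ≥0∞)⁻¹ • (Measure.count : Measure (Fin n))) :=
    fun z => Integrable.of_finite
  simp_rw [fun z => integral_fintype (this z), smul_eq_mul]
  refine Finset.measurable_sum _ fun w _ => Measurable.const_mul ?_ _
  exact (measurable_hPat σ).comp (measurable_pi_lambda _ fun i => measurable_pi_apply (w i))

/-- The remainder in the first-order expansion of the pattern density around `ν`. -/
def tPatRemainder (ν L : Measure Ω2) : ℝ :=
  tPat σ L - tPat σ ν - (∫ z, localField σ ν z ∂L - ∫ z, localField σ ν z ∂ν)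

theorem measurable_tPatRemainder (ν : Measure Ω2) [IsProbabilityMeasure ν] (hn : n ≠ 0) :
    Measurable fun z : Fin n → Ω2 => tPatRemainder σ ν (empM z) := by
  unfold tPatRemainder
  simp_rw [integral_empM]
  refine ((measurable_tPat_empM σ hn).sub_const _).sub (Measurable.sub_const
    (Measurable.const_mul (Finset.measurable_sum _ fun i _ => ?_) _) _)
  exact (measurable_localField σ ν).comp (measurable_pi_apply i)

theorem abs_tPatRemainder_le (ν L : Measure Ω2) [IsProbabilityMeasure ν]
    [IsProbabilityMeasure L] : |tPatRemainder σ ν L| ≤ 1 + k := by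
  have hI : ∀ (P : Measure Ω2) [IsProbabilityMeasure P],
      ∫ z, localField σ ν z ∂P ∈ Set.Icc (0 : ℝ) k := by
    intro P _
    refine ⟨integral_nonneg fun z => (localField_mem σ ν z).1, ?_⟩
    refine (integral_mono_of_nonneg (ae_of_all _ fun z => (localField_mem σ ν z).1)
      (integrable_const (k : ℝ)) (ae_of_all _ fun z => (localField_mem σ ν z).2)).trans ?_
    simp
  have h1 := tPat_mem σ L
  have h2 := tPat_mem σ ν
  have h3 := hI L
  have h4 := hI ν
  unfold tPatRemainder
  rw [abs_le]
  constructor <;> linarith [h1.1, h1.2, h2.1, h2.2, h3.1, h3.2, h4.1, h4.2]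

theorem integrable_exp_tPatRemainder (ν P : Measure Ω2) [IsProbabilityMeasure ν]
    [IsProbabilityMeasure P] (hn : n ≠ 0) (c : ℝ) :
    Integrable (fun z => Real.exp (c * tPatRemainder σ ν (empM z))) (pmeas P n) := by
  have : IsProbabilityMeasure (pmeas P n) := by unfold pmeas; infer_instance
  refine Integrable.of_bound ((measurable_tPatRemainder σ ν hn).const_mul
    c).exp.aestronglyMeasurable (Real.exp (|c| * (1 + k))) (ae_of_all _ fun z => ?_)
  have := isProbabilityMeasure_empM hn z
  rw [Real.norm_eq_abs, Real.abs_exp]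
  refine Real.exp_le_exp.2 ((le_abs_self _).trans ?_)
  rw [abs_mul]
  exact mul_le_mul_of_nonneg_left (abs_tPatRemainder_le σ ν _) (abs_nonneg c)

theorem integrable_exp_tPat (P : Measure Ω2) [IsProbabilityMeasure P] (hn : n ≠ 0) (c : ℝ) :
    Integrable (fun z => Real.exp (c * tPat σ (empM z))) (pmeas P n) := by
  have : IsProbabilityMeasure (pmeas P n) := by unfold pmeas; infer_instance
  refine Integrable.of_bound ((measurable_tPat_empM σ hn).const_mul
    c).exp.aestronglyMeasurable (Real.exp (|c| * 1)) (ae_of_all _ fun z => ?_)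
  have := isProbabilityMeasure_empM hn z
  have h := tPat_mem σ (empM z)
  rw [Real.norm_eq_abs, Real.abs_exp]
  refine Real.exp_le_exp.2 ((le_abs_self _).trans ?_)
  rw [abs_mul, abs_of_nonneg h.1]
  exact mul_le_mul_of_nonneg_left h.2 (abs_nonneg c)

theorem exp_tPat_empM_eq {μ ν : Measure Ω2} {θ : ℝ} (hn : n ≠ 0) :
    ∃ c0 : ℝ, ∀ z : Fin n → Ω2, Real.exp (n * θ * tPat σ (empM z)) =
      Real.exp c0 * ((∏ i, tiltDens μ θ (localField σ ν) (z i)) *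
        Real.exp (n * θ * tPatRemainder σ ν (empM z))) := by
  refine ⟨n * (Real.log (∫ x, Real.exp (θ * localField σ ν x) ∂μ) + θ * tPat σ ν -
    θ * ∫ z, localField σ ν z ∂ν), fun z => ?_⟩
  unfold tiltDens tPatRemainder
  rw [← Real.exp_sum, ← Real.exp_add, ← Real.exp_add, integral_empM, Finset.sum_sub_distrib,
    ← Finset.mul_sum, Finset.sum_const, Finset.card_univ, Fintype.card_fin, nsmul_eq_mul]
  congr 1
  have hn' : (n : ℝ) ≠ 0 := by exact_mod_cast hn
  field_simp
  ring

theorem Qgibbs_apply {μ : ProbabilityMeasure Ω2} (hμ : μ ∈ Mcal) {ν : Measure Ω2}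
    [IsProbabilityMeasure ν] {θ : ℝ}
    (hν : ν = densMeasure μ (tiltDens μ θ (localField σ ν))) (hn : n ≠ 0)
    {S : Set (Fin n → Ω2)} (hS : MeasurableSet S) :
    Qgibbs σ (μ : Measure Ω2) θ n S = ENNReal.ofReal
      ((∫ z in S, Real.exp (n * θ * tPatRemainder σ ν (empM z)) ∂pmeas ν n) /
        ∫ z, Real.exp (n * θ * tPatRemainder σ ν (empM z)) ∂pmeas ν n) := by
  have hprob : IsProbabilityMeasure (pmeas (μ : Measure Ω2) n) := by unfold pmeas; infer_instance
  have hW := integrable_exp_tPat σ (μ : Measure Ω2) hn (n * θ)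
  set W : (Fin n → Ω2) → ℝ := fun z => Real.exp (n * θ * tPat σ (empM z)) with hWdef
  have hae : ∀ᵐ z ∂pmeas (μ : Measure Ω2) n,
      Real.exp (n * θ * tPerm σ (inducedPerm z)) = W z := by
    filter_upwards [ae_genericPts hμ n] with z hz
    rw [hz.tPerm_inducedPerm σ hn]
  have hFn : Real.exp (Fn σ (μ : Measure Ω2) θ n) = ∫ z, W z ∂pmeas (μ : Measure Ω2) n := by
    rw [Fn, integral_congr_ae hae, Real.exp_log (integral_exp_pos hW)]
  obtain ⟨c0, hc0⟩ := exp_tPat_empM_eq σ (μ := (μ : Measure Ω2)) (ν := ν) (θ := θ) hn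
  have hg : IsProbDensity (μ : Measure Ω2) (tiltDens μ θ (localField σ ν)) :=
    isProbDensity_tiltDens (measurable_localField σ ν) (localField_mem σ ν) θ
  have hchange : ∀ φ : (Fin n → Ω2) → ℝ, ∫ z, W z * φ z ∂pmeas (μ : Measure Ω2) n =
      Real.exp c0 * ∫ z, Real.exp (n * θ * tPatRemainder σ ν (empM z)) * φ z ∂pmeas ν n := by
    intro φ
    have h := integral_pi_densMeasure (ι := Fin n) (fun _ => hg)
      fun z => Real.exp (n * θ * tPatRemainder σ ν (empM z)) * φ z
    rw [← hν] at h
    rw [pmeas, pmeas, h, ← integral_const_mul]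
    refine integral_congr_ae (ae_of_all _ fun z => ?_)
    simp only [hWdef, hc0]
    ring
  have hone := hchange fun _ => 1
  have hind := hchange (S.indicator fun _ => 1)
  simp only [mul_one] at hone
  have hmulind : ∀ f : (Fin n → Ω2) → ℝ,
      (fun z => f z * S.indicator (fun _ => (1 : ℝ)) z) = S.indicator f := by
    intro f; ext z; by_cases hz : z ∈ S <;> simp [hz]
  rw [hmulind, hmulind fun z => Real.exp (n * θ * tPatRemainder σ ν (empM z)),
    integral_indicator hS, integral_indicator hS] at hind
  have hratio : (∫ z in S, Real.exp (n * θ * tPatRemainder σ ν (empM z)) ∂pmeas ν n) /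
        ∫ z, Real.exp (n * θ * tPatRemainder σ ν (empM z)) ∂pmeas ν n =
      (∫ z in S, W z ∂pmeas (μ : Measure Ω2) n) / ∫ z, W z ∂pmeas (μ : Measure Ω2) n := by
    rw [hone, hind, mul_div_mul_left _ _ (Real.exp_pos c0).ne']
  rw [hratio, Qgibbs, withDensity_apply _ hS, ← integral_div, ofReal_integral_eq_lintegral_ofReal
    (hW.integrableOn.div_const _) (ae_of_all _ fun z => div_nonneg (Real.exp_pos _).le
      (integral_nonneg fun _ => (Real.exp_pos _).le))]
  refine lintegral_congr_ae (ae_restrict_of_ae ?_)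
  filter_upwards [hae] with z hz
  rw [Real.exp_sub, hz, hFn]

end ChangeOfMeasure

section Tail

variable {k n m : ℕ} (σ : Equiv.Perm (Fin k)) {α β : ℝ → Fin (m + 1)}

theorem inv_le_integral_exp_neg {Ω : Type*} [MeasurableSpace Ω] {P : Measure Ω}
    [IsProbabilityMeasure P] {X : Ω → ℝ} (h1 : Integrable (fun z => Real.exp (X z)) P)
    (h2 : Integrable (fun z => Real.exp (-X z)) P) {M : ℝ} (hM : 0 < M)
    (h : ∫ z, Real.exp (X z) ∂P ≤ M) : M⁻¹ ≤ ∫ z, Real.exp (-X z) ∂P := by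
  have hpt : ∀ z, 2 * M⁻¹ - M⁻¹ ^ 2 * Real.exp (X z) ≤ Real.exp (-X z) := by
    intro z
    have he := Real.exp_pos (X z)
    rw [Real.exp_neg]
    have : 0 ≤ (Real.exp (X z))⁻¹ * (1 - M⁻¹ * Real.exp (X z)) ^ 2 := by positivity
    have e : (Real.exp (X z))⁻¹ * (1 - M⁻¹ * Real.exp (X z)) ^ 2 =
        (Real.exp (X z))⁻¹ - (2 * M⁻¹ - M⁻¹ ^ 2 * Real.exp (X z)) := by
      field_simp; ring
    linarith
  have hi : Integrable (fun z => 2 * M⁻¹ - M⁻¹ ^ 2 * Real.exp (X z)) P :=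
    (integrable_const _).sub (h1.const_mul _)
  have := integral_mono hi h2 hpt
  rw [integral_sub (integrable_const _) (h1.const_mul _),
    integral_const_mul (M⁻¹ ^ 2) fun z => Real.exp (X z)] at this
  simp only [integral_const, probReal_univ, smul_eq_mul, one_mul] at this
  have h3 : M⁻¹ ^ 2 * ∫ z, Real.exp (X z) ∂P ≤ M⁻¹ := by
    calc _ ≤ M⁻¹ ^ 2 * M := by gcongr
      _ = M⁻¹ := by field_simp
  linarith

theorem Qgibbs_gridDev_le {μ : ProbabilityMeasure Ω2} (hμ : μ ∈ Mcal) {ν : Measure Ω2}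
    [IsProbabilityMeasure ν] {θ : ℝ}
    (hν : ν = densMeasure μ (tiltDens μ θ (localField σ ν)))
    (hα : Measurable α) (hβ : Measurable β) {b : ℝ}
    (hR : ∀ z : Fin n → Ω2, |θ| * |tPatRemainder σ ν (empM z)| ≤
      gridDev α β ν (empM z) ^ 2 / 4 + b) (hn : n ≠ 0) {s : ℝ} (hs : 0 ≤ s) :
    Qgibbs σ (μ : Measure Ω2) θ n {z | s ≤ gridDev α β ν (empM z)} ≤ ENNReal.ofReal
      ((3 * (2 * n + 1) * 2 ^ ((m + 1) ^ 2)) ^ 2 * Real.exp (n * (2 * b - s ^ 2 / 4))) := by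
  have hprob : IsProbabilityMeasure (pmeas ν n) := by unfold pmeas; infer_instance
  set D : (Fin n → Ω2) → ℝ := fun z => gridDev α β ν (empM z) with hD
  have hDm : Measurable D := measurable_gridDev hα hβ ν
  have hS : MeasurableSet {z | s ≤ D z} := measurableSet_le measurable_const hDm
  set M : ℝ := 3 * (2 * n + 1) * 2 ^ ((m + 1) ^ 2) with hM
  have hM0 : 0 < M := by positivity
  have hexpM : ∫ z, Real.exp (n / 2 * D z ^ 2) ∂pmeas ν n ≤ M := integral_exp_gridDev_le hα hβ ν hn
  have hintp : Integrable (fun z => Real.exp (n / 2 * D z ^ 2)) (pmeas ν n) :=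
    integrable_exp_gridDev hα hβ ν hn _
  have hintn : Integrable (fun z => Real.exp (-(n / 2 * D z ^ 2))) (pmeas ν n) := by
    simpa only [neg_mul] using integrable_exp_gridDev hα hβ ν hn (-(n / 2))
  have hRint := integrable_exp_tPatRemainder σ ν ν hn (n * θ)
  rw [Qgibbs_apply σ hμ hν hn hS]
  refine ENNReal.ofReal_le_ofReal ?_
  have habs : ∀ z, |n * θ * tPatRemainder σ ν (empM z)| ≤ n * (D z ^ 2 / 4 + b) := fun z => by
    rw [mul_assoc, abs_mul, abs_mul, Nat.abs_cast]
    exact mul_le_mul_of_nonneg_left (hR z) (Nat.cast_nonneg n)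
  have hden : Real.exp (-(n * b)) * M⁻¹ ≤
      ∫ z, Real.exp (n * θ * tPatRemainder σ ν (empM z)) ∂pmeas ν n := by
    calc _ ≤ Real.exp (-(n * b)) * ∫ z, Real.exp (-(n / 2 * D z ^ 2)) ∂pmeas ν n := by
          gcongr; exact inv_le_integral_exp_neg hintp hintn hM0 hexpM
      _ = ∫ z, Real.exp (-(n * b)) * Real.exp (-(n / 2 * D z ^ 2)) ∂pmeas ν n :=
          (integral_const_mul _ _).symm
      _ ≤ _ := by
          refine integral_mono (hintn.const_mul _) hRint fun z => ?_
          simp only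
          rw [← Real.exp_add]
          refine Real.exp_le_exp.2 ?_
          have := (abs_le.1 (habs z)).1
          have : 0 ≤ n * D z ^ 2 := by positivity
          nlinarith
  have hnum : ∫ z in {z | s ≤ D z}, Real.exp (n * θ * tPatRemainder σ ν (empM z)) ∂pmeas ν n ≤
      Real.exp (n * (b - s ^ 2 / 4)) * M := by
    calc _ ≤ ∫ z in {z | s ≤ D z}, Real.exp (n * (b - s ^ 2 / 4)) *
          Real.exp (n / 2 * D z ^ 2) ∂pmeas ν n := by
          refine setIntegral_mono_on hRint.integrableOn (hintp.const_mul _).integrableOn hS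
            fun z hz => ?_
          rw [← Real.exp_add]
          refine Real.exp_le_exp.2 ?_
          have h1 := (abs_le.1 (habs z)).2
          have h2 : s ^ 2 ≤ D z ^ 2 := pow_le_pow_left₀ hs hz 2
          have h3 : n * s ^ 2 ≤ n * D z ^ 2 := mul_le_mul_of_nonneg_left h2 (Nat.cast_nonneg n)
          nlinarith
      _ ≤ ∫ z, Real.exp (n * (b - s ^ 2 / 4)) * Real.exp (n / 2 * D z ^ 2) ∂pmeas ν n :=
          setIntegral_le_integral (hintp.const_mul _) (ae_of_all _ fun z => by positivity)
      _ = Real.exp (n * (b - s ^ 2 / 4)) * ∫ z, Real.exp (n / 2 * D z ^ 2) ∂pmeas ν n :=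
          integral_const_mul _ _
      _ ≤ _ := by gcongr
  have hden0 : 0 < Real.exp (-(n * b)) * M⁻¹ := by positivity
  refine (div_le_div₀ (by positivity) hnum hden0 hden).trans_eq ?_
  rw [div_eq_iff hden0.ne']
  have : Real.exp (n * (2 * b - s ^ 2 / 4)) * Real.exp (-(n * b)) =
      Real.exp (n * (b - s ^ 2 / 4)) := by rw [← Real.exp_add]; ring_nf
  rw [← this]
  field_simp

end Tail

section LevyProkhorov

theorem levyProkhorovEDist_map_le_of_cells {I : Type*} {L ν : Measure Ω2} [IsProbabilityMeasure L]
    [IsProbabilityMeasure ν] {f g : Ω2 → Ω2} (hf : Measurable f) (hg : Measurable g) {κ : Ω2 → I}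
    {δ r : ℝ} (hδ0 : 0 ≤ δ) (hδ : ∀ S : Set I, |L.real (κ ⁻¹' S) - ν.real (κ ⁻¹' S)| ≤ δ)
    (hfg : ∀ p q, κ p = κ q → dist (f p) (g q) ≤ r) (hδr : δ ≤ r) :
    levyProkhorovEDist (L.map f) (ν.map g) ≤ ENNReal.ofReal r := by
  have := Measure.isProbabilityMeasure_map (μ := L) hf.aemeasurable
  have := Measure.isProbabilityMeasure_map (μ := ν) hg.aemeasurable
  refine levyProkhorovEDist_le_of_forall_le _ _ _ fun ε B hε hε' hB => ?_
  have hr : r < ε.toReal := by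
    rwa [ENNReal.ofReal_lt_iff_lt_toReal (hδ0.trans hδr) hε'.ne] at hε
  rw [Measure.map_apply hf hB, Measure.map_apply hg Metric.isOpen_thickening.measurableSet]
  set S := κ '' (f ⁻¹' B)
  have h1 : f ⁻¹' B ⊆ κ ⁻¹' S := Set.subset_preimage_image _ _
  have h2 : κ ⁻¹' S ⊆ g ⁻¹' Metric.thickening ε.toReal B := by
    rintro q ⟨p, hp, hpq⟩
    refine Metric.mem_thickening_iff.2 ⟨f p, hp, ?_⟩
    rw [dist_comm]
    exact (hfg p q hpq).trans_lt hr
  have h3 : L (κ ⁻¹' S) ≤ ν (κ ⁻¹' S) + ENNReal.ofReal δ := by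
    rw [← ofReal_measureReal, ← ofReal_measureReal (μ := ν),
      ← ENNReal.ofReal_add measureReal_nonneg hδ0]
    exact ENNReal.ofReal_le_ofReal (by linarith [(abs_le.1 (hδ S)).2])
  calc L (f ⁻¹' B) ≤ L (κ ⁻¹' S) := measure_mono h1
    _ ≤ ν (κ ⁻¹' S) + ENNReal.ofReal δ := h3
    _ ≤ _ := add_le_add (measure_mono h2) ((ENNReal.ofReal_le_ofReal hδr).trans hε.le)

theorem abs_measureReal_le_sub_le {m : ℕ} {L ν : Measure Ω2} [IsProbabilityMeasure L]
    [IsProbabilityMeasure ν] {f : Ω2 → ℝ} (hf : Measurable f) {α : ℝ → Fin (m + 1)}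
    (hα : Monotone α) (hα' : Measurable α) {δ b : ℝ}
    (hδ : ∀ C : Set (Fin (m + 1)),
      |L.real ((fun z => α (f z)) ⁻¹' C) - ν.real ((fun z => α (f z)) ⁻¹' C)| ≤ δ)
    (hb : ∀ c, ν.real ((fun z => α (f z)) ⁻¹' {c}) ≤ b) (x : ℝ) :
    |L.real {p | f p ≤ x} - ν.real {p | f p ≤ x}| ≤ δ + b := by
  have hm : Measurable fun z => α (f z) := hα'.comp hf
  have h1 : ∀ (P : Measure Ω2) [IsProbabilityMeasure P],
      P.real ((fun z => α (f z)) ⁻¹' Set.Iio (α x)) ≤ P.real {p | f p ≤ x} := fun P _ =>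
    measureReal_mono (fun p (hp : α (f p) < α x) => (hα.reflect_lt hp).le) (measure_ne_top _ _)
  have h2 : ∀ (P : Measure Ω2) [IsProbabilityMeasure P],
      P.real {p | f p ≤ x} ≤ P.real ((fun z => α (f z)) ⁻¹' Set.Iic (α x)) := fun P _ =>
    measureReal_mono (fun p hp => hα hp) (measure_ne_top _ _)
  have h3 : ν.real ((fun z => α (f z)) ⁻¹' Set.Iic (α x)) ≤
      ν.real ((fun z => α (f z)) ⁻¹' Set.Iio (α x)) + b := by
    rw [← Set.Iio_union_right, Set.preimage_union]
    exact (measureReal_union_le _ _).trans (by gcongr; exact hb _)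
  have h4 := abs_le.1 (hδ (Set.Iic (α x)))
  have h5 := abs_le.1 (hδ (Set.Iio (α x)))
  have := h1 L
  have := h1 ν
  have := h2 L
  have := h2 ν
  rw [abs_le]
  constructor <;> linarith

variable {m n : ℕ} {α β : ℝ → Fin (m + 1)}

theorem abs_measureReal_gridMap_sub_le (hα : Measurable α) (hβ : Measurable β) (ν L : Measure Ω2)
    [IsProbabilityMeasure ν] [IsProbabilityMeasure L] (S : Set (Fin (m + 1) × Fin (m + 1))) :
    |L.real (gridMap α β ⁻¹' S) - ν.real (gridMap α β ⁻¹' S)| ≤ gridDev α β ν L := by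
  classical
  have hκ := measurable_gridMap hα hβ
  have hsum : ∀ (P : Measure Ω2) [IsProbabilityMeasure P], P.real (gridMap α β ⁻¹' S) =
      ∑ a ∈ Finset.univ.filter (· ∈ S), P.real (gridMap α β ⁻¹' {a}) := by
    intro P _
    rw [sum_measureReal_preimage_singleton _ fun a _ => hκ (measurableSet_singleton a)]
    simp
  rw [hsum L, hsum ν, ← Finset.sum_sub_distrib]
  exact (Finset.abs_sum_le_sum_abs _ _).trans
    (Finset.sum_le_sum_of_subset_of_nonneg (Finset.filter_subset _ _) fun _ _ _ => abs_nonneg _)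

theorem empM_map (z : Fin n → Ω2) {f : Ω2 → Ω2} (hf : Measurable f) :
    (empM z).map f = empM fun i => f (z i) := by
  rw [empM, empM, Measure.map_smul, ← Measure.mapₗ_apply_of_measurable hf, map_sum]
  simp only [Measure.mapₗ_apply_of_measurable hf, Measure.map_dirac' hf]

theorem measurable_cdfX_cdfY (P : Measure Ω2) [IsProbabilityMeasure P] :
    Measurable fun p : Ω2 => (cdfX P p.1, cdfY P p.2) := by
  have hx : Monotone (cdfX P) := fun x y hxy =>
    measureReal_mono (fun p (hp : p.1 ≤ x) => hp.trans hxy) (measure_ne_top _ _)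
  have hy : Monotone (cdfY P) := fun x y hxy =>
    measureReal_mono (fun p (hp : p.2 ≤ x) => hp.trans hxy) (measure_ne_top _ _)
  exact (hx.measurable.comp measurable_fst).prodMk (hy.measurable.comp measurable_snd)

theorem GenericPts.dLPE_le {z : Fin n → Ω2} (hz : GenericPts z) (hn : n ≠ 0) {ν : Measure Ω2}
    [IsProbabilityMeasure ν] (hα : Monotone α) (hβ : Monotone β) (hα' : Measurable α)
    (hβ' : Measurable β) {b : ℝ} (hb : 0 ≤ b)
    (h1 : ∀ c, ν.real ((fun z => α z.1) ⁻¹' {c}) ≤ b)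
    (h2 : ∀ c, ν.real ((fun z => β z.2) ⁻¹' {c}) ≤ b)
    (h3 : ∀ x y, α x = α y → |cdfX ν x - cdfX ν y| ≤ b)
    (h4 : ∀ x y, β x = β y → |cdfY ν x - cdfY ν y| ≤ b) :
    dLPE (EmM (inducedPerm z)) (Omap ν) ≤ ENNReal.ofReal (gridDev α β ν (empM z) + 2 * b) := by
  have := isProbabilityMeasure_empM hn z
  have hcell := abs_measureReal_gridMap_sub_le hα' hβ' ν (empM z)
  have hX := abs_measureReal_le_sub_le measurable_fst hα hα'
    (fun C => hcell (Prod.fst ⁻¹' C)) h1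
  have hY := abs_measureReal_le_sub_le measurable_snd hβ hβ'
    (fun C => hcell (Prod.snd ⁻¹' C)) h2
  rw [hz.EmM_inducedPerm, ← empM_map z (measurable_cdfX_cdfY (empM z)), Omap, dLPE]
  refine levyProkhorovEDist_map_le_of_cells (measurable_cdfX_cdfY _) (measurable_cdfX_cdfY _)
    (gridDev_nonneg _ _ _ _) hcell (fun p q hpq => ?_) (by linarith)
  have hp1 : α p.1 = α q.1 := congrArg Prod.fst hpq
  have hp2 : β p.2 = β q.2 := congrArg Prod.snd hpq
  rw [Prod.dist_eq, Real.dist_eq, Real.dist_eq]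
  refine max_le ?_ ?_
  · have e1 : |cdfX (empM z) p.1 - cdfX ν p.1| ≤ _ := hX p.1
    have e2 := h3 _ _ hp1
    linarith [abs_sub_le (cdfX (empM z) p.1) (cdfX ν p.1) (cdfX ν q.1)]
  · have e1 : |cdfY (empM z) p.2 - cdfY ν p.2| ≤ _ := hY p.2
    have e2 := h4 _ _ hp2
    linarith [abs_sub_le (cdfY (empM z) p.2) (cdfY ν p.2) (cdfY ν q.2)]

end LevyProkhorov

section Coarsening

/-- A monotone coarsening of the real line adapted to the distribution of `f` under `ν`. -/
theorem exists_adapted_coarsening (ν : Measure Ω2) [IsProbabilityMeasure ν] {f : Ω2 → ℝ}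
    (hf : Measurable f) (h0 : ∀ x, ν.map f {x} = 0) {m : ℕ} (hm : 0 < m) :
    ∃ α : ℝ → Fin (m + 1), Measurable α ∧ Monotone α ∧
      (∀ c, ν.real ((fun z => α (f z)) ⁻¹' {c}) ≤ 1 / m) ∧
      ∀ x y, α x = α y → |ν.real {p | f p ≤ x} - ν.real {p | f p ≤ y}| ≤ 1 / m := by
  have := Measure.isProbabilityMeasure_map (μ := ν) hf.aemeasurable
  obtain ⟨α, hα', hα, h1, h2⟩ := exists_coarsening (ν.map f) h0 hm
  have hm' : (0 : ℝ) < m := by exact_mod_cast hm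
  have hcdf : ∀ x, ProbabilityTheory.cdf (ν.map f) x = ν.real {p | f p ≤ x} := fun x => by
    rw [ProbabilityTheory.cdf_eq_real, map_measureReal_apply hf measurableSet_Iic]; rfl
  refine ⟨α, hα', hα, fun c => ?_, fun x y hxy => ?_⟩
  · have := h2 c
    rwa [map_measureReal_apply hf (hα' (measurableSet_singleton c))] at this
  · rw [← hcdf, ← hcdf, le_div_iff₀ hm', ← abs_of_pos hm', ← abs_mul, abs_le]
    have e1 := h1 x
    have e2 := h1 y
    rw [hxy] at e1
    constructor <;> linarith [e1.1, e1.2, e2.1, e2.2]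

end Coarsening

section Convergence

theorem tendsto_sq_mul_exp_neg (C : ℝ) {c : ℝ} (hc : 0 < c) :
    Tendsto (fun n : ℕ => (3 * (2 * (n : ℝ) + 1) * C) ^ 2 * Real.exp (n * -c)) atTop (𝓝 0) := by
  have hx : Tendsto (fun n : ℕ => c * (n : ℝ)) atTop atTop :=
    tendsto_natCast_atTop_atTop.const_mul_atTop hc
  have h := fun j => (Real.tendsto_pow_mul_exp_neg_atTop_nhds_zero j).comp hx
  have h2 := (((h 2).const_mul (4 / c ^ 2)).add ((h 1).const_mul (4 / c))).add (h 0)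
  have h3 := h2.const_mul (9 * C ^ 2)
  simp only [mul_zero, add_zero] at h3
  refine h3.congr fun n => ?_
  simp only [Function.comp_apply, pow_zero, pow_one]
  rw [show (n : ℝ) * -c = -(c * n) by ring]
  field_simp
  ring

variable {k : ℕ} (σ : Equiv.Perm (Fin k))

theorem tendsto_Qgibbs_dLPE {μ ν : ProbabilityMeasure Ω2} (hμ : μ ∈ Mcal) (hνM : ν ∈ Mcal)
    {θ : ℝ}
    (hν : (ν : Measure Ω2) = densMeasure μ (tiltDens μ θ (localField σ (ν : Measure Ω2))))
    (hθ₁ : |θ| * (2 * k ^ 2 * 2 ^ k) ≤ 1 / 4) (hθ₂ : |θ| * (6 * k ^ 3 + 4 * k ^ 2) ≤ 1)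
    {ε : ℝ} (hε : 0 < ε) :
    Tendsto (fun n : ℕ => Qgibbs σ (μ : Measure Ω2) θ n
      {z | ENNReal.ofReal ε ≤ dLPE (EmM (inducedPerm z)) (Omap (ν : Measure Ω2))})
      atTop (𝓝 0) := by
  set s : ℝ := ε / 2 with hs
  have hs0 : 0 < s := by positivity
  obtain ⟨m, hm⟩ := exists_nat_gt (1 / min (s / 2) (s ^ 2 / 16))
  have hmin : 0 < min (s / 2) (s ^ 2 / 16) := by positivity
  have hm' : (0 : ℝ) < m := (by positivity : (0 : ℝ) < 1 / min (s / 2) (s ^ 2 / 16)).trans hm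
  have hm0 : 0 < m := by exact_mod_cast hm'
  have hb : (1 : ℝ) / m ≤ min (s / 2) (s ^ 2 / 16) := by
    rw [div_le_iff₀ hm']
    rw [div_lt_iff₀ hmin] at hm
    linarith
  have hb1 : (1 : ℝ) / m ≤ s / 2 := hb.trans (min_le_left _ _)
  have hb2 : (1 : ℝ) / m ≤ s ^ 2 / 16 := hb.trans (min_le_right _ _)
  have hb0 : (0 : ℝ) ≤ 1 / m := by positivity
  obtain ⟨α, hα', hα, hα1, hα2⟩ :=
    exists_adapted_coarsening (ν : Measure Ω2) measurable_fst hνM.2.1 hm0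
  obtain ⟨β, hβ', hβ, hβ1, hβ2⟩ :=
    exists_adapted_coarsening (ν : Measure Ω2) measurable_snd hνM.2.2 hm0
  have hlim := tendsto_sq_mul_exp_neg (2 ^ ((m + 1) ^ 2)) (c := s ^ 2 / 8) (by positivity)
  have hlim' := ENNReal.tendsto_ofReal hlim
  rw [ENNReal.ofReal_zero] at hlim'
  refine tendsto_of_tendsto_of_tendsto_of_le_of_le' tendsto_const_nhds hlim'
    (Eventually.of_forall fun _ => zero_le) ?_
  filter_upwards [eventually_ne_atTop 0] with n hn
  have hR : ∀ z : Fin n → Ω2, |θ| * |tPatRemainder σ (ν : Measure Ω2) (empM z)| ≤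
      gridDev α β (ν : Measure Ω2) (empM z) ^ 2 / 4 + 1 / m := by
    intro z
    have := isProbabilityMeasure_empM hn z
    have h := abs_tPat_sub_sub_localField_le σ hα hβ hα' hβ' (ν : Measure Ω2) (empM z) hb0 hα1 hβ1
    have h' := mul_le_mul_of_nonneg_left h (abs_nonneg θ)
    refine h'.trans ?_
    have e1 := mul_le_mul_of_nonneg_right hθ₁ (sq_nonneg (gridDev α β (ν : Measure Ω2) (empM z)))
    have e2 := mul_le_mul_of_nonneg_right hθ₂ hb0
    linarith
  have htail := Qgibbs_gridDev_le σ hμ hν hα' hβ' hR hn hs0.le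
  have hgen : ∀ᵐ z ∂Qgibbs σ (μ : Measure Ω2) θ n, GenericPts z :=
    (withDensity_absolutelyContinuous _ _).ae_le (ae_genericPts hμ n)
  refine (measure_mono_ae ?_).trans (htail.trans (ENNReal.ofReal_le_ofReal ?_))
  · filter_upwards [hgen] with z hz hzε
    have h := hz.dLPE_le hn hα hβ hα' hβ' hb0 hα1 hβ1 hα2 hβ2
    have h0 := gridDev_nonneg α β (ν : Measure Ω2) (empM z)
    have h2 := (ENNReal.ofReal_le_ofReal_iff (by positivity)).1 (le_trans hzε h)
    change s ≤ gridDev α β (ν : Measure Ω2) (empM z)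
    linarith
  · refine mul_le_mul_of_nonneg_left (Real.exp_le_exp.2 ?_) (by positivity)
    exact mul_le_mul_of_nonneg_left (by linarith) (Nat.cast_nonneg n)

end Convergence

/-- Theorem 1.10 (i): for every `k` there is `θ_c > 0` depending only on
`k` such that for every pattern `σ ∈ S_k`, every `μ ∈ ℳ` and every `θ ∈ (−θ_c,θ_c)`,
the variational problem has a unique maximizer `ν_{σ,μ,θ}`, and `Em(π_{n,σ,μ,θ})`
converges in probability (in Lévy–Prokhorov distance) to `𝒪(ν_{σ,μ,θ})`. -/
theorem gibbs_high_temperature (k : ℕ) :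
    ∃ θc > (0 : ℝ), ∀ (σ : Equiv.Perm (Fin k)) (μ : ProbabilityMeasure Ω2), μ ∈ Mcal →
      ∀ θ ∈ Set.Ioo (-θc) θc,
        ∃ ν : ProbabilityMeasure Ω2, Fset σ (↑μ) θ = {ν} ∧
          ∀ ε > (0 : ℝ),
            Tendsto (fun n : ℕ =>
                Qgibbs σ (↑μ) θ n
                  {z | ENNReal.ofReal ε ≤ dLPE (EmM (inducedPerm z)) (Omap ↑ν)})
              atTop (𝓝 0) := by
  refine ⟨1 / (64 * (k + 1) ^ 3 * 2 ^ k), by positivity, fun σ μ hμ θ hθ => ?_⟩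
  have hθ' : |θ| * (64 * (k + 1) ^ 3 * 2 ^ k) ≤ 1 := by
    rw [← le_div_iff₀ (by positivity)]
    exact (abs_lt.2 hθ).le
  have hk : (0 : ℝ) ≤ k := Nat.cast_nonneg k
  have hpow : (1 : ℝ) ≤ 2 ^ k := one_le_pow₀ (by norm_num)
  have hle : ∀ c : ℝ, c ≤ 64 * (k + 1) ^ 3 * 2 ^ k → |θ| * c ≤ 1 := fun c hc =>
    (mul_le_mul_of_nonneg_left hc (abs_nonneg θ)).trans hθ'
  have hpoly : ∀ c : ℝ, c ≤ 64 * (k + 1) ^ 3 → c ≤ 64 * (k + 1) ^ 3 * 2 ^ k := fun c hc =>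
    hc.trans (le_mul_of_one_le_right (by positivity) hpow)
  have h8 : |θ| * (8 * k ^ 2 * 2 ^ k) ≤ 1 := by
    refine hle _ (mul_le_mul_of_nonneg_right ?_ (by positivity))
    nlinarith [pow_nonneg hk 3, pow_nonneg hk 2]
  have h2 : |θ| * (2 * k) ≤ 1 := by
    refine hle _ (hpoly _ ?_)
    nlinarith [pow_nonneg hk 3, pow_nonneg hk 2]
  have h6 : |θ| * (6 * k ^ 3 + 4 * k ^ 2) ≤ 1 := by
    refine hle _ (hpoly _ ?_)
    nlinarith [pow_nonneg hk 3, pow_nonneg hk 2]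
  obtain ⟨u, hu, hK, hfix⟩ := exists_localField_tiltDens_eq σ (μ : Measure Ω2) (θ := θ)
    (by linarith) (by linarith)
  have hprob := (isProbDensity_tiltDens (μ := (μ : Measure Ω2)) hu hK θ).isProbabilityMeasure
  let ν : ProbabilityMeasure Ω2 := ⟨densMeasure μ (tiltDens μ θ u), hprob⟩
  have hac : (ν : Measure Ω2) ≪ μ := withDensity_absolutelyContinuous _ _
  have hfixν : localField σ (ν : Measure Ω2) = u := hfix
  refine ⟨ν, Fset_eq_singleton σ hμ (by linarith) hu hK rfl hfix, fun ε hε => ?_⟩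
  refine tendsto_Qgibbs_dLPE σ hμ (mem_Mcal_of_absolutelyContinuous hμ hac) ?_ (by linarith) h6 hε
  rw [hfixν]
  rfl

end
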